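/- Let d ≥ 2, let 2 ≤ m ≤ d, and let i_1, …, i_{2m−2} be positive integers with i_1 + ⋯ + i_{2m−2} = m(m−1) and each i_k ≤ d. Set ε := (3d)^{−12d}(50d)^{−3d²/2} and let T(w) be the degree (3/2)m(m−1) Taylor polynomial at w = 0 of the function w ↦ ∏_{k=1}^{2m−2} R(d − i_k, w). Then for every integer n ≥ 1 with w(n) ∈ (0, ε], one has |∏_{k=1}^{2m−2} p(n + d − i_k)/p(n) − T(w(n))| ≤ 2e²·(3d)^{10d−10}·(4cd)^{3d²/2}·w(n)^{(3/2)m(m−1)+1}. -/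

import Mathlib

/-- The partition function: the number of partitions of `n`. -/
noncomputable def partitionFun (n : ℕ) : ℕ := Fintype.card (Nat.Partition n)

noncomputable def cconst : ℝ := 2 * Real.pi ^ 2 / 3

noncomputable def wfun (n : ℕ) : ℝ := 1 / Real.sqrt (cconst * ((n : ℝ) - 1 / 24))

/-- The function `R(j, w)` approximating `p(n+j)/p(n)`. -/
noncomputable def Rfun (j : ℕ) (w : ℝ) : ℝ :=
  Real.exp (cconst * j * w / (1 + Real.sqrt (1 + cconst * j * w ^ 2))) *
      (Real.sqrt (1 + cconst * j * w ^ 2) - w) /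
    ((1 - w) * (1 + cconst * j * w ^ 2) ^ ((3 : ℝ) / 2))

/-! ### The generating function of the partition numbers -/

section GeneratingFunction

open PowerSeries Filter Topology
open scoped PowerSeries.WithPiTopology

/-- `f` converges absolutely at `q`, with value `v`. -/
def HasAbsEval (f : ℂ⟦X⟧) (q v : ℂ) : Prop :=
  Summable (fun n => ‖coeff n f * q ^ n‖) ∧ ∑' n, coeff n f * q ^ n = v

lemma HasAbsEval.mul {f g : ℂ⟦X⟧} {q u v : ℂ} (hf : HasAbsEval f q u) (hg : HasAbsEval g q v) :
    HasAbsEval (f * g) q (u * v) := by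
  have key : ∀ n, ∑ kl ∈ Finset.HasAntidiagonal.antidiagonal n,
      (coeff kl.1 f * q ^ kl.1) * (coeff kl.2 g * q ^ kl.2) = coeff n (f * g) * q ^ n := by
    intro n
    rw [coeff_mul, Finset.sum_mul]
    refine Finset.sum_congr rfl fun kl hkl => ?_
    rw [← Finset.HasAntidiagonal.mem_antidiagonal.mp hkl, pow_add]
    ring
  refine ⟨?_, ?_⟩
  · simpa only [key] using summable_norm_sum_mul_antidiagonal_of_summable_norm hf.1 hg.1
  · rw [← hf.2, ← hg.2, tsum_mul_tsum_eq_tsum_sum_antidiagonal_of_summable_norm hf.1 hg.1]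
    exact tsum_congr fun n => (key n).symm

lemma hasAbsEval_one (q : ℂ) : HasAbsEval 1 q 1 := by
  have h0 : ∀ n ≠ 0, coeff n (1 : ℂ⟦X⟧) * q ^ n = 0 := fun n hn => by simp [coeff_one, hn]
  refine ⟨summable_of_ne_finset_zero (s := {0}) fun n hn => ?_, ?_⟩
  · rw [h0 n (by simpa using hn), norm_zero]
  · rw [tsum_eq_single 0 h0]
    simp

lemma coeff_tsum_X_pow (i n : ℕ) :
    coeff n (∑' j : ℕ, (X : ℂ⟦X⟧) ^ ((i + 1) * j)) = if (i + 1) ∣ n then 1 else 0 := by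
  have hs : Summable (fun j : ℕ => (X : ℂ⟦X⟧) ^ ((i + 1) * j)) := by
    simp_rw [pow_mul]
    exact WithPiTopology.summable_pow_of_constantCoeff_eq_zero (by simp)
  have := (hs.hasSum.map (coeff n) (WithPiTopology.continuous_coeff ℂ n)).tsum_eq
  rw [← this]
  simp only [Function.comp_def, coeff_X_pow]
  split_ifs with h
  · obtain ⟨k, rfl⟩ := h
    rw [tsum_eq_single k]
    · simp
    · intro b hb
      simp [hb.symm]
  · convert tsum_zero with j
    have : n ≠ (i + 1) * j := fun hn => h ⟨j, hn⟩
    simp [this]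

lemma hasAbsEval_geometric (i : ℕ) {q : ℂ} (hq : ‖q‖ < 1) :
    HasAbsEval (∑' j : ℕ, (X : ℂ⟦X⟧) ^ ((i + 1) * j)) q (1 - q ^ (i + 1))⁻¹ := by
  have hinj : Function.Injective (fun j : ℕ => (i + 1) * j) :=
    fun a b h => Nat.eq_of_mul_eq_mul_left (Nat.succ_pos i) h
  have hq' : ‖q ^ (i + 1)‖ < 1 := by
    rw [norm_pow]
    exact pow_lt_one₀ (norm_nonneg _) hq (Nat.succ_ne_zero i)
  have hz : ∀ n ∉ Set.range (fun j : ℕ => (i + 1) * j),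
      (if (i + 1) ∣ n then (1 : ℂ) else 0) * q ^ n = 0 := by
    intro n hn
    have : ¬ (i + 1) ∣ n := fun ⟨k, hk⟩ => hn ⟨k, hk.symm⟩
    simp [this]
  refine ⟨?_, ?_⟩
  · simp only [coeff_tsum_X_pow]
    rw [← hinj.summable_iff]
    · simpa [Function.comp_def, pow_mul] using
        summable_geometric_of_lt_one (norm_nonneg _) hq'
    · intro n hn
      rw [hz n hn, norm_zero]
  · simp only [coeff_tsum_X_pow]
    refine HasSum.tsum_eq ?_
    rw [← hinj.hasSum_iff hz]
    simpa [Function.comp_def, pow_mul] using hasSum_geometric_of_norm_lt_one hq'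

lemma hasAbsEval_prod (M : ℕ) {q : ℂ} (hq : ‖q‖ < 1) :
    HasAbsEval (∏ i ∈ Finset.range M, ∑' j : ℕ, (X : ℂ⟦X⟧) ^ ((i + 1) * j)) q
      (∏ i ∈ Finset.range M, (1 - q ^ (i + 1))⁻¹) := by
  induction M with
  | zero => simpa using hasAbsEval_one q
  | succ M ih =>
    rw [Finset.prod_range_succ, Finset.prod_range_succ]
    exact ih.mul (hasAbsEval_geometric M hq)

lemma tendsto_coeff_partition (n : ℕ) :
    Tendsto (fun M => coeff n (∏ i ∈ Finset.range M, ∑' j : ℕ, (X : ℂ⟦X⟧) ^ ((i + 1) * j)))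
      atTop (𝓝 (partitionFun n : ℂ)) := by
  have h := (Nat.Partition.hasProd_powerSeriesMk_card_restricted ℂ
    (fun _ => True)).tendsto_prod_nat
  have h2 := (WithPiTopology.tendsto_iff_coeff_tendsto ℂ _ _ _).mp h n
  simpa [Nat.Partition.restricted, partitionFun, Finset.card_univ] using h2

lemma integral_exp_int_mul (k : ℤ) :
    ∫ θ in (-Real.pi)..Real.pi, Complex.exp (k * Complex.I * θ) =
      if k = 0 then (2 * Real.pi : ℂ) else 0 := by
  split_ifs with h
  · subst h
    simp [two_mul]
  · rw [integral_exp_mul_complex (by simp [h])]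
    rw [div_eq_zero_iff]
    left
    rw [sub_eq_zero, Complex.exp_eq_exp_iff_exists_int]
    exact ⟨k, by push_cast; ring⟩

/-- Fourier coefficients of an absolutely convergent power series. -/
lemma HasAbsEval.integral_eq {f : ℂ⟦X⟧} {F : ℝ → ℂ} {s : ℝ}
    (h : ∀ θ : ℝ, HasAbsEval f (Complex.exp (-(s + θ * Complex.I))) (F θ)) (n : ℕ) :
    ∫ θ in (-Real.pi)..Real.pi, F θ * Complex.exp (n * (s + θ * Complex.I)) =
      2 * Real.pi * coeff n f := by
  have hnorm : ∀ θ : ℝ, ‖Complex.exp (-(s + θ * Complex.I))‖ = Real.exp (-s) := by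
    intro θ
    simp [Complex.norm_exp]
  have hsum : Summable fun m => ‖coeff m f‖ * Real.exp (-s) ^ m := by
    have := (h 0).1
    simpa only [norm_mul, norm_pow, hnorm] using this
  have hI := intervalIntegral.hasSum_integral_of_dominated_convergence
    (μ := MeasureTheory.volume) (a := -Real.pi) (b := Real.pi)
    (F := fun m (θ : ℝ) => coeff m f * Complex.exp (-(s + θ * Complex.I)) ^ m *
      Complex.exp (n * (s + θ * Complex.I)))
    (f := fun θ : ℝ => F θ * Complex.exp (n * (s + θ * Complex.I)))
    (fun m _ => ‖coeff m f‖ * Real.exp (-s) ^ m * Real.exp (n * s))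
    (fun m => by
      apply Continuous.aestronglyMeasurable
      fun_prop)
    (fun m => by
      refine Filter.Eventually.of_forall fun θ _ => le_of_eq ?_
      rw [norm_mul, norm_mul, norm_pow, hnorm]
      simp [Complex.norm_exp])
    (Filter.Eventually.of_forall fun θ _ => hsum.mul_right _)
    (by simp)
    (Filter.Eventually.of_forall fun θ _ => by
      refine HasSum.mul_right _ ?_
      rw [← (h θ).2]
      exact (Summable.of_norm (h θ).1).hasSum)
  rw [← hI.tsum_eq, tsum_eq_single n]
  · have : ∀ θ : ℝ, coeff n f * Complex.exp (-(s + θ * Complex.I)) ^ n *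
      Complex.exp (n * (s + θ * Complex.I)) = coeff n f := by
      intro θ
      rw [← Complex.exp_nat_mul, mul_assoc, ← Complex.exp_add, ← mul_add, neg_add_cancel,
        mul_zero, Complex.exp_zero, mul_one]
    simp only [this]
    rw [intervalIntegral.integral_const]
    simp [two_mul]
  · intro m hm
    have : ∀ θ : ℝ, coeff m f * Complex.exp (-(s + θ * Complex.I)) ^ m *
        Complex.exp (n * (s + θ * Complex.I)) = (coeff m f * Complex.exp (((n : ℂ) - m) * s)) *
          Complex.exp (((n - m : ℤ) : ℂ) * Complex.I * θ) := by
      intro θ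
      rw [← Complex.exp_nat_mul, mul_assoc, mul_assoc, ← Complex.exp_add, ← Complex.exp_add]
      congr 2
      push_cast
      ring
    simp only [this]
    rw [intervalIntegral.integral_const_mul, integral_exp_int_mul, if_neg (by omega), mul_zero]

/-- Euler's product `∏ (1 - q ^ k)`. -/
noncomputable def eulerPhi (q : ℂ) : ℂ := ∏' k : ℕ, (1 - q ^ (k + 1))

lemma one_sub_pow_ne_zero {q : ℂ} (hq : ‖q‖ < 1) (k : ℕ) : 1 - q ^ (k + 1) ≠ 0 := by
  intro h
  have h1 : ‖q ^ (k + 1)‖ < 1 := by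
    rw [norm_pow]
    exact pow_lt_one₀ (norm_nonneg _) hq (Nat.succ_ne_zero k)
  rw [← sub_eq_zero.mp h] at h1
  simp at h1

lemma eulerPhi_ne_zero {q : ℂ} (hq : ‖q‖ < 1) : eulerPhi q ≠ 0 := by
  have := tprod_one_add_ne_zero_of_summable (f := fun k => -q ^ (k + 1))
    (fun i => by simpa [← sub_eq_add_neg] using one_sub_pow_ne_zero hq i)
    (by simpa using (summable_nat_add_iff 1).mpr (summable_geometric_of_lt_one (norm_nonneg _) hq))
  simpa [eulerPhi, sub_eq_add_neg] using this

lemma tendsto_prod_eulerPhi {q : ℂ} (hq : ‖q‖ < 1) :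
    Tendsto (fun M => ∏ i ∈ Finset.range M, (1 - q ^ (i + 1))) atTop (𝓝 (eulerPhi q)) :=
  (ModularForm.multipliable_one_sub_pow hq).hasProd.tendsto_prod_nat

lemma tendsto_prod_inv_eulerPhi {q : ℂ} (hq : ‖q‖ < 1) :
    Tendsto (fun M => ∏ i ∈ Finset.range M, (1 - q ^ (i + 1))⁻¹) atTop (𝓝 (eulerPhi q)⁻¹) := by
  simp only [Finset.prod_inv_distrib]
  exact (tendsto_prod_eulerPhi hq).inv₀ (eulerPhi_ne_zero hq)

lemma norm_one_sub_pow_inv_le {q : ℂ} (hq : ‖q‖ < 1) (i : ℕ) :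
    ‖(1 - q ^ (i + 1))⁻¹‖ ≤ (1 - ‖q‖ ^ (i + 1))⁻¹ := by
  rw [norm_inv]
  have h1 : ‖q‖ ^ (i + 1) < 1 := pow_lt_one₀ (norm_nonneg _) hq (Nat.succ_ne_zero i)
  refine inv_anti₀ (by linarith) ?_
  have := norm_sub_norm_le (1 : ℂ) (q ^ (i + 1))
  simpa using this

lemma exists_bound_prod_inv {r : ℝ} (h0 : 0 ≤ r) (h1 : r < 1) :
    ∃ C : ℝ, ∀ q : ℂ, ‖q‖ = r → ∀ M,
      ‖∏ i ∈ Finset.range M, (1 - q ^ (i + 1))⁻¹‖ ≤ C := by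
  have hr : ‖(r : ℂ)‖ = r := by simp [abs_of_nonneg h0]
  have ht := (tendsto_prod_inv_eulerPhi (q := (r : ℂ)) (by rw [hr]; exact h1)).norm
  obtain ⟨C, hC⟩ := ht.bddAbove_range
  refine ⟨C, fun q hq M => le_trans ?_ (hC ⟨M, rfl⟩)⟩
  simp only [norm_prod]
  refine Finset.prod_le_prod (fun _ _ => norm_nonneg _) fun i _ => ?_
  refine (norm_one_sub_pow_inv_le (by rw [hq]; exact h1) i).trans (le_of_eq ?_)
  rw [hq]
  have h2 : r ^ (i + 1) < 1 := pow_lt_one₀ h0 h1 (Nat.succ_ne_zero i)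
  rw [norm_inv]
  have : (1 : ℂ) - (r : ℂ) ^ (i + 1) = ((1 - r ^ (i + 1) : ℝ) : ℂ) := by push_cast; rfl
  rw [this, Complex.norm_real, Real.norm_of_nonneg (by linarith)]

lemma norm_exp_neg_lt_one {s : ℝ} (hs : 0 < s) (θ : ℝ) :
    ‖Complex.exp (-(s + θ * Complex.I))‖ < 1 := by
  simp [Complex.norm_exp, hs]

/-- Cauchy's formula for the partition numbers. -/
theorem integral_eulerPhi_inv (n : ℕ) {s : ℝ} (hs : 0 < s) :
    ∫ θ in (-Real.pi)..Real.pi, (eulerPhi (Complex.exp (-(s + θ * Complex.I))))⁻¹ *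
      Complex.exp (n * (s + θ * Complex.I)) = 2 * Real.pi * partitionFun n := by
  have hq := norm_exp_neg_lt_one hs
  have hnorm : ∀ θ : ℝ, ‖Complex.exp (-(s + θ * Complex.I))‖ = Real.exp (-s) := by
    intro θ
    simp [Complex.norm_exp]
  obtain ⟨C, hC⟩ := exists_bound_prod_inv (Real.exp_pos (-s)).le (by simpa using hs)
  have hM : ∀ M, ∫ θ in (-Real.pi)..Real.pi,
      (∏ i ∈ Finset.range M, (1 - Complex.exp (-(s + θ * Complex.I)) ^ (i + 1))⁻¹) *
        Complex.exp (n * (s + θ * Complex.I)) = _ :=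
    fun M => HasAbsEval.integral_eq (s := s) (fun θ => hasAbsEval_prod M (hq θ)) n
  have hlim := intervalIntegral.tendsto_integral_filter_of_dominated_convergence
    (μ := MeasureTheory.volume) (a := -Real.pi) (b := Real.pi) (l := atTop)
    (F := fun M (θ : ℝ) =>
      (∏ i ∈ Finset.range M, (1 - Complex.exp (-(s + θ * Complex.I)) ^ (i + 1))⁻¹) *
        Complex.exp (n * (s + θ * Complex.I)))
    (f := fun θ : ℝ => (eulerPhi (Complex.exp (-(s + θ * Complex.I))))⁻¹ *
      Complex.exp (n * (s + θ * Complex.I)))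
    (fun _ => C * Real.exp (n * s))
    (Filter.Eventually.of_forall fun M => by
      apply Continuous.aestronglyMeasurable
      refine Continuous.mul ?_ (by fun_prop)
      refine continuous_finsetProd _ fun i _ => Continuous.inv₀ (by fun_prop) fun θ => ?_
      exact one_sub_pow_ne_zero (hq θ) i)
    (Filter.Eventually.of_forall fun M => Filter.Eventually.of_forall fun θ _ => by
      rw [norm_mul]
      refine mul_le_mul (hC _ (hnorm θ) M) (le_of_eq ?_) (norm_nonneg _)
        ((norm_nonneg _).trans (hC _ (hnorm θ) M))
      simp [Complex.norm_exp])
    (by simp)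
    (Filter.Eventually.of_forall fun θ _ => (tendsto_prod_inv_eulerPhi (hq θ)).mul_const _)
  refine tendsto_nhds_unique hlim ?_
  simp only [hM]
  exact (tendsto_coeff_partition n).const_mul _

end GeneratingFunction

/-! ### The modular transformation and bounds for the generating function -/

section Bounds

open Filter Topology

lemma cpow_half_I_mul {t : ℂ} (ht : 0 < t.re) :
    (Complex.I * t) ^ (2⁻¹ : ℂ) = Complex.I ^ (2⁻¹ : ℂ) * t ^ (2⁻¹ : ℂ) := by
  have h := Complex.abs_arg_lt_pi_div_two_iff.mpr (Or.inl ht)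
  rw [abs_lt] at h
  have ht0 : t ≠ 0 := fun h0 => by simp [h0] at ht
  have hlog : Complex.log (Complex.I * t) = Complex.log Complex.I + Complex.log t := by
    rw [Complex.log_mul_eq_add_log_iff Complex.I_ne_zero ht0, Complex.arg_I]
    constructor <;> linarith [h.1, h.2]
  rw [Complex.cpow_def_of_ne_zero (mul_ne_zero Complex.I_ne_zero ht0),
    Complex.cpow_def_of_ne_zero Complex.I_ne_zero, Complex.cpow_def_of_ne_zero ht0, hlog,
    add_mul, Complex.exp_add]

/-- The transformation formula of the generating function of the partition numbers. -/
theorem eulerPhi_inv_modular {t : ℂ} (ht : 0 < t.re) :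
    (eulerPhi (Complex.exp (-t)))⁻¹ =
      ((Real.sqrt (2 * Real.pi) : ℝ) : ℂ)⁻¹ * t ^ (2⁻¹ : ℂ) *
        Complex.exp (Real.pi ^ 2 / 6 / t - t / 24) *
        (eulerPhi (Complex.exp (-(4 * Real.pi ^ 2 / t))))⁻¹ := by
  have hpi : (Real.pi : ℂ) ≠ 0 := by exact_mod_cast Real.pi_ne_zero
  have ht0 : t ≠ 0 := fun h0 => by simp [h0] at ht
  set z : ℂ := Complex.I * t * (((2 * Real.pi)⁻¹ : ℝ) : ℂ) with hz
  have hzim : z ∈ UpperHalfPlane.upperHalfPlaneSet := by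
    show 0 < z.im
    rw [hz, Complex.im_mul_ofReal]
    simp only [Complex.I_mul_im]
    positivity
  have key := ModularForm.eta_comp_eq_csqrt_I_inv hzim
  have hphi : ∀ u : ℂ, ModularForm.eta u =
      Complex.exp (2 * Real.pi * Complex.I * u / 24) *
        eulerPhi (Complex.exp (2 * Real.pi * Complex.I * u)) := by
    intro u
    simp only [ModularForm.eta, eulerPhi, ModularForm.eta_q_eq_pow, Function.Periodic.qParam]
    norm_num
  have h1 : 2 * Real.pi * Complex.I * z = -t := by
    rw [hz]
    push_cast
    field_simp
    rw [Complex.I_sq]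
  have h2 : 2 * Real.pi * Complex.I * (-1 / z) = -(4 * Real.pi ^ 2 / t) := by
    rw [hz]
    push_cast
    field_simp
    norm_num
  have hsq : z ^ (2⁻¹ : ℂ) =
      Complex.I ^ (2⁻¹ : ℂ) * t ^ (2⁻¹ : ℂ) * ((Real.sqrt (2 * Real.pi) : ℝ) : ℂ)⁻¹ := by
    have h2pi : 0 < (2 * Real.pi)⁻¹ := by positivity
    have hIt : Complex.I * t ≠ 0 := mul_ne_zero Complex.I_ne_zero ht0
    have hr : ((((2 * Real.pi)⁻¹ : ℝ) : ℂ)) ^ (2⁻¹ : ℂ) =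
        ((Real.sqrt (2 * Real.pi) : ℝ) : ℂ)⁻¹ := by
      rw [← Complex.ofReal_inv, ← Real.sqrt_inv, Real.sqrt_eq_rpow,
        Complex.ofReal_cpow h2pi.le]
      norm_num
    rw [← cpow_half_I_mul ht, ← hr, hz, Complex.cpow_def_of_ne_zero (mul_ne_zero hIt
      (by exact_mod_cast h2pi.ne')), Complex.log_mul_ofReal _ h2pi _ hIt, add_mul, Complex.exp_add,
      Complex.cpow_def_of_ne_zero hIt, Complex.cpow_def_of_ne_zero (by exact_mod_cast h2pi.ne'),
      Complex.ofReal_log h2pi.le, mul_comm]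
  simp only [Function.comp_apply, Pi.smul_apply, Pi.mul_apply, smul_eq_mul, Complex.sqrt,
    hphi, h1, h2, hsq] at key
  have hI : Complex.I ^ (2⁻¹ : ℂ) ≠ 0 := by simp [Complex.cpow_eq_zero_iff]
  have hn1 : eulerPhi (Complex.exp (-t)) ≠ 0 :=
    eulerPhi_ne_zero (by simpa [Complex.norm_exp] using ht)
  have hre : 0 < (4 * Real.pi ^ 2 / t).re := by
    rw [show (4 * Real.pi ^ 2 / t : ℂ) = ((4 * Real.pi ^ 2 : ℝ) : ℂ) * t⁻¹ by
      push_cast; rw [div_eq_mul_inv], Complex.re_ofReal_mul, Complex.inv_re]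
    have := Complex.normSq_pos.mpr ht0
    positivity
  have hn2 : eulerPhi (Complex.exp (-(4 * Real.pi ^ 2 / t))) ≠ 0 :=
    eulerPhi_ne_zero (by rw [Complex.norm_exp, Complex.neg_re, Real.exp_lt_one_iff]; linarith)
  have he : Complex.exp (Real.pi ^ 2 / 6 / t - t / 24) =
      Complex.exp (-t / 24) * (Complex.exp (-(4 * Real.pi ^ 2 / t) / 24))⁻¹ := by
    rw [← Complex.exp_neg, ← Complex.exp_add]
    congr 1
    field_simp
    ring
  rw [he]
  have hs : ((Real.sqrt (2 * Real.pi) : ℝ) : ℂ) ≠ 0 := by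
    simp [Real.sqrt_eq_zero', Real.pi_pos]
  have hE := Complex.exp_ne_zero (-(4 * Real.pi ^ 2 / t) / 24)
  field_simp
  field_simp at key
  linear_combination key

lemma norm_eulerPhi_inv_sub_one_le {q : ℂ} (hq : ‖q‖ ≤ 1 / 10) :
    ‖(eulerPhi q)⁻¹ - 1‖ ≤ 4 * ‖q‖ := by
  have hq1 : ‖q‖ < 1 := by linarith
  set x := ‖q‖ with hx
  have hx0 : 0 ≤ x := norm_nonneg q
  have h1 : ‖eulerPhi q - 1‖ ≤ Real.exp (x / (1 - x)) - 1 := by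
    refine le_of_tendsto ((tendsto_prod_eulerPhi hq1).sub_const 1).norm
      (Eventually.of_forall fun M => ?_)
    have := Finset.norm_prod_one_add_sub_one_le (Finset.range M) (fun i => -q ^ (i + 1))
    simp only [← sub_eq_add_neg, norm_neg, norm_pow] at this
    refine this.trans ?_
    gcongr
    have hs := (hasSum_geometric_of_lt_one hx0 hq1).mul_left x
    rw [← div_eq_mul_inv] at hs
    refine (le_of_eq ?_).trans (sum_le_hasSum (Finset.range M) (fun i _ => by positivity) hs)
    exact Finset.sum_congr rfl fun i _ => by ring
  have h2 : Real.exp (x / (1 - x)) - 1 ≤ 2 * x := by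
    have hy : x / (1 - x) ≤ 10 / 9 * x := by
      rw [div_le_iff₀ (by linarith)]
      nlinarith
    have hy0 : 0 ≤ x / (1 - x) := div_nonneg hx0 (by linarith)
    set y := x / (1 - x)
    have hy1 : y ≤ 1 / 9 := by linarith
    have := Real.abs_exp_sub_one_sub_id_le (x := y) (by rw [abs_of_nonneg hy0]; linarith)
    have := (abs_le.mp this).2
    nlinarith
  have h3 : ‖eulerPhi q - 1‖ ≤ 2 * x := h1.trans h2
  have h4 : 1 - 2 * x ≤ ‖eulerPhi q‖ := by
    have := norm_sub_norm_le (1 : ℂ) (1 - eulerPhi q)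
    rw [norm_sub_rev] at h3
    simp only [norm_one, sub_sub_cancel] at this
    linarith
  have h5 : (eulerPhi q)⁻¹ - 1 = -(eulerPhi q - 1) * (eulerPhi q)⁻¹ := by
    have := eulerPhi_ne_zero hq1
    field_simp
    ring
  rw [h5, norm_mul, norm_neg, norm_inv, ← div_eq_mul_inv, div_le_iff₀ (by linarith)]
  nlinarith [norm_nonneg (eulerPhi q)]

lemma exp_neg_le_of_ten_le {x : ℝ} (hx : 10 ≤ x) : Real.exp (-x) ≤ 1 / 10 := by
  rw [Real.exp_neg, inv_le_comm₀ (Real.exp_pos _) (by norm_num)]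
  have := Real.add_one_le_exp x
  norm_num
  linarith

lemma norm_eulerPhi_inv_ofReal_le {s : ℝ} (hs : 0 < s) (hs1 : s ≤ 1) :
    ‖(eulerPhi (Real.exp (-s) : ℝ))⁻¹‖ ≤ 2 * Real.exp (Real.pi ^ 2 / 6 / s) := by
  have hpi := Real.pi_gt_three
  have h := eulerPhi_inv_modular (t := (s : ℂ)) (by simpa using hs)
  have hx : 10 ≤ 4 * Real.pi ^ 2 / s := by
    rw [le_div_iff₀ hs]
    nlinarith
  have hq : ‖Complex.exp (-(4 * Real.pi ^ 2 / s))‖ ≤ 1 / 10 := by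
    have : (-(4 * Real.pi ^ 2 / s) : ℂ) = ((-(4 * Real.pi ^ 2 / s) : ℝ) : ℂ) := by push_cast; rfl
    rw [this, Complex.norm_exp, Complex.ofReal_re]
    exact exp_neg_le_of_ten_le hx
  have hb := norm_eulerPhi_inv_sub_one_le hq
  have hb2 : ‖(eulerPhi (Complex.exp (-(4 * Real.pi ^ 2 / s))))⁻¹‖ ≤ 2 := by
    have := norm_sub_norm_le (eulerPhi (Complex.exp (-(4 * Real.pi ^ 2 / s))))⁻¹ 1
    rw [norm_one] at this
    linarith
  have harg : ((Real.exp (-s) : ℝ) : ℂ) = Complex.exp (-(s : ℂ)) := by push_cast; rfl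
  rw [harg, h, norm_mul, norm_mul, norm_mul]
  have e1 : ‖(((Real.sqrt (2 * Real.pi) : ℝ) : ℂ))⁻¹‖ ≤ 1 := by
    rw [norm_inv, Complex.norm_real, Real.norm_of_nonneg (Real.sqrt_nonneg _)]
    apply inv_le_one_of_one_le₀
    rw [Real.one_le_sqrt]
    linarith
  have e2 : ‖(s : ℂ) ^ (2⁻¹ : ℂ)‖ ≤ 1 := by
    rw [Complex.norm_cpow_eq_rpow_re_of_pos hs]
    exact Real.rpow_le_one hs.le hs1 (by norm_num)
  have e3 : ‖Complex.exp (Real.pi ^ 2 / 6 / s - s / 24)‖ ≤ Real.exp (Real.pi ^ 2 / 6 / s) := by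
    have : (Real.pi ^ 2 / 6 / s - s / 24 : ℂ) = ((Real.pi ^ 2 / 6 / s - s / 24 : ℝ) : ℂ) := by
      push_cast; rfl
    rw [this, Complex.norm_exp, Complex.ofReal_re]
    gcongr
    linarith
  calc _ ≤ 1 * 1 * Real.exp (Real.pi ^ 2 / 6 / s) * 2 := by gcongr
    _ = _ := by ring

lemma one_sub_norm_mul_exp_le {z : ℂ} (hz : ‖z‖ < 1) :
    (1 - ‖z‖) * Real.exp ‖z‖ ≤ ‖1 - z‖ * Real.exp z.re := by
  have hr0 := norm_nonneg z
  have hne : 1 - z ≠ 0 := by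
    intro h
    rw [← sub_eq_zero.mp h] at hz
    simp at hz
  have key : Real.log (1 - ‖z‖) + ‖z‖ ≤ Real.log ‖1 - z‖ + z.re := by
    have h1 := Complex.hasSum_re (Complex.hasSum_taylorSeries_neg_log hz)
    have h2 := Complex.hasSum_re (Complex.hasSum_taylorSeries_neg_log (z := (‖z‖ : ℂ)) (by simpa using hz))
    have h3 := h2.sub h1
    have hle := sum_le_hasSum {1} (fun i _ => ?_) h3
    · simp only [Finset.sum_singleton, pow_one, Nat.cast_one, div_one, Complex.ofReal_re,
        Complex.neg_re, Complex.log_re] at hle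
      have : ‖(1 : ℂ) - (‖z‖ : ℂ)‖ = 1 - ‖z‖ := by
        rw [← Complex.ofReal_one, ← Complex.ofReal_sub, Complex.norm_real,
          Real.norm_of_nonneg (by linarith)]
      rw [this] at hle
      linarith
    · rw [← Complex.ofReal_pow, ← Complex.ofReal_natCast, ← Complex.ofReal_div,
        Complex.ofReal_re, Complex.div_ofReal_re, ← sub_div]
      apply div_nonneg _ (Nat.cast_nonneg _)
      have := Complex.re_le_norm (z ^ i)
      rw [norm_pow] at this
      linarith
  have := Real.exp_le_exp.mpr key
  rwa [Real.exp_add, Real.exp_add, Real.exp_log (by linarith),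
    Real.exp_log (norm_pos_iff.mpr hne)] at this

lemma norm_eulerPhi_inv_le {q : ℂ} (hq : ‖q‖ < 1) :
    ‖(eulerPhi q)⁻¹‖ ≤ ‖(eulerPhi (‖q‖ : ℝ))⁻¹‖ *
      Real.exp (-(‖q‖ / (1 - ‖q‖) - ‖q‖ / ‖1 - q‖)) := by
  set r := ‖q‖ with hr
  have hr0 : 0 ≤ r := norm_nonneg q
  have hrn : ‖(r : ℂ)‖ = r := by simp [abs_of_nonneg hr0]
  have hq1 : ‖(r : ℂ)‖ < 1 := by rwa [hrn]
  have hne : 1 - q ≠ 0 := by simpa using one_sub_pow_ne_zero hq 0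
  have hs1 : HasSum (fun i => r ^ (i + 1)) (r / (1 - r)) := by
    have := (hasSum_geometric_of_lt_one hr0 hq).mul_left r
    simpa [pow_succ', div_eq_mul_inv] using this
  have hs2 : HasSum (fun i => (q ^ (i + 1)).re) (q / (1 - q)).re := by
    have := (hasSum_geometric_of_norm_lt_one hq).mul_left q
    have := Complex.hasSum_re this
    simpa [pow_succ', div_eq_mul_inv] using this
  have hlim := (tendsto_prod_inv_eulerPhi hq1).norm.mul
    ((hs1.sub hs2).tendsto_sum_nat.neg.rexp)
  have hle : ‖(eulerPhi q)⁻¹‖ ≤ ‖(eulerPhi (r : ℂ))⁻¹‖ *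
      Real.exp (-(r / (1 - r) - (q / (1 - q)).re)) := by
    refine le_of_tendsto_of_tendsto' (tendsto_prod_inv_eulerPhi hq).norm hlim fun M => ?_
    rw [← Finset.sum_neg_distrib, Real.exp_sum, norm_prod, norm_prod, ← Finset.prod_mul_distrib]
    refine Finset.prod_le_prod (fun _ _ => norm_nonneg _) fun i _ => ?_
    have hz : ‖q ^ (i + 1)‖ < 1 := by
      rw [norm_pow]
      exact pow_lt_one₀ hr0 hq (Nat.succ_ne_zero i)
    have h := one_sub_norm_mul_exp_le hz
    have e1 : ‖(1 - (r : ℂ) ^ (i + 1))⁻¹‖ = (1 - ‖q ^ (i + 1)‖)⁻¹ := by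
      rw [norm_inv, ← Complex.ofReal_pow, ← Complex.ofReal_one, ← Complex.ofReal_sub,
        Complex.norm_real, norm_pow, Real.norm_of_nonneg]
      rw [norm_pow] at hz
      linarith
    rw [e1, ← norm_pow, norm_inv]
    have hp : 0 < ‖1 - q ^ (i + 1)‖ := norm_pos_iff.mpr (one_sub_pow_ne_zero hq i)
    rw [neg_sub, Real.exp_sub, inv_mul_eq_div, inv_eq_one_div, div_div,
      div_le_div_iff₀ hp (mul_pos (Real.exp_pos _) (by linarith)), one_mul]
    linarith
  refine hle.trans ?_
  gcongr
  refine (Complex.re_le_norm _).trans (le_of_eq ?_)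
  rw [norm_div]

/-- The generating function is small away from the positive real axis. -/
lemma norm_eulerPhi_inv_minor_le {s θ : ℝ} (hs : 0 < s) (hs1 : s ≤ 1) (hθ : s ≤ |θ|)
    (hθπ : |θ| ≤ Real.pi) :
    ‖(eulerPhi (Complex.exp (-(s + θ * Complex.I))))⁻¹‖ ≤
      2 * Real.exp (Real.pi ^ 2 / 6 / s - 3 / 20 / s + 1) := by
  have hq := norm_exp_neg_lt_one hs θ
  have hnorm : ‖Complex.exp (-(s + θ * Complex.I))‖ = Real.exp (-s) := by simp [Complex.norm_exp]
  have h := norm_eulerPhi_inv_le hq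
  have hreal := norm_eulerPhi_inv_ofReal_le hs hs1
  rw [hnorm] at h
  set r := Real.exp (-s) with hr
  have hr0 : 0 < r := Real.exp_pos _
  have hrs : r * s ≤ 1 - r := by
    have : r * Real.exp s = 1 := by rw [hr, ← Real.exp_add]; simp
    nlinarith [Real.add_one_le_exp s]
  have hr1 : r < 1 := by nlinarith
  have h1 : 1 / s - 1 ≤ r / (1 - r) := by
    have : 1 - s ≤ r := by have := Real.add_one_le_exp (-s); linarith
    rw [div_sub_one hs.ne', div_le_div_iff₀ hs (by linarith)]
    nlinarith
  have h2 : r / ‖1 - Complex.exp (-(s + θ * Complex.I))‖ ≤ 17 / 20 / s := by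
    have hsq : ‖1 - Complex.exp (-(s + θ * Complex.I))‖ ^ 2 =
        (1 - r) ^ 2 + 2 * r * (1 - Real.cos θ) := by
      rw [← Complex.normSq_eq_norm_sq, Complex.normSq_apply]
      simp only [Complex.sub_re, Complex.one_re, Complex.sub_im, Complex.one_im,
        Complex.exp_re, Complex.exp_im, Complex.neg_re, Complex.neg_im, Complex.add_re,
        Complex.add_im, Complex.ofReal_re, Complex.ofReal_im, Complex.mul_re, Complex.mul_im,
        Complex.I_re, Complex.I_im]
      simp only [mul_zero, mul_one, sub_zero, add_zero, zero_add, Real.cos_neg, Real.sin_neg,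
        ← hr]
      nlinarith [Real.sin_sq_add_cos_sq θ]
    have hcos := Real.cos_le_one_sub_mul_cos_sq hθπ
    have hpi2 : Real.pi ^ 2 ≤ 10 := by nlinarith [Real.pi_lt_d2, Real.pi_gt_three]
    have hθ2 : s ^ 2 ≤ θ ^ 2 := by
      rw [← sq_abs θ]
      exact pow_le_pow_left₀ hs.le hθ 2
    have hc2 : 1 / 5 * s ^ 2 ≤ 1 - Real.cos θ := by
      have : 1 / 5 * s ^ 2 ≤ 2 / Real.pi ^ 2 * θ ^ 2 := by
        refine mul_le_mul ?_ hθ2 (by positivity) (by positivity)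
        rw [div_le_div_iff₀ (by norm_num) (by positivity)]
        linarith
      linarith
    have hlow : (20 / 17 * (r * s)) ^ 2 ≤ ‖1 - Complex.exp (-(s + θ * Complex.I))‖ ^ 2 := by
      rw [hsq]
      have a1 : (r * s) ^ 2 ≤ (1 - r) ^ 2 := pow_le_pow_left₀ (by positivity) hrs 2
      have a2 : 2 / 5 * (r * s) ^ 2 ≤ 2 * r * (1 - Real.cos θ) := by
        have : r * (1 / 5 * s ^ 2) ≤ r * (1 - Real.cos θ) := mul_le_mul_of_nonneg_left hc2 hr0.le
        have b : r ^ 2 * s ^ 2 ≤ r * s ^ 2 := by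
          apply mul_le_mul_of_nonneg_right _ (sq_nonneg s)
          nlinarith
        nlinarith
      nlinarith
    have hlow2 := le_of_sq_le_sq hlow (norm_nonneg _)
    have hpos : 0 < 20 / 17 * (r * s) := by positivity
    rw [div_le_div_iff₀ (by linarith) hs]
    linarith
  refine h.trans ?_
  refine (mul_le_mul hreal (Real.exp_le_exp.mpr ?_) (Real.exp_pos _).le (by positivity)).trans
    (le_of_eq (?_ : 2 * Real.exp (Real.pi ^ 2 / 6 / s) * Real.exp (-(3 / 20 / s) + 1) = _))
  · have : 17 / 20 / s + 3 / 20 / s = 1 / s := by rw [← add_div]; norm_num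
    linarith
  · rw [mul_assoc, ← Real.exp_add]
    congr 2
    ring

end Bounds

/-! ### Laplace transforms of powers and their inversion -/

section Laplace

open MeasureTheory Filter Topology ProbabilityTheory Set

/-- The measure `x ^ (a - 1) dx` on the positive half-line. -/
noncomputable def powerMeasure (a : ℝ) : Measure ℝ :=
  (volume.restrict (Ioi 0)).withDensity fun x => (Real.toNNReal (x ^ (a - 1)) : ENNReal)

lemma integral_powerMeasure {E : Type*} [NormedAddCommGroup E] [NormedSpace ℝ E] (a : ℝ)
    (g : ℝ → E) : ∫ x, g x ∂(powerMeasure a) = ∫ x in Ioi (0 : ℝ), x ^ (a - 1) • g x := by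
  have hm : Measurable fun x : ℝ => Real.toNNReal (x ^ (a - 1)) := by fun_prop
  rw [powerMeasure, integral_withDensity_eq_integral_smul hm]
  refine setIntegral_congr_fun measurableSet_Ioi fun x hx => ?_
  simp only [NNReal.smul_def, Real.coe_toNNReal _ (Real.rpow_nonneg (le_of_lt hx) _)]

lemma integrableOn_rpow_mul_exp_neg_mul {a s : ℝ} (ha : 0 < a) (hs : 0 < s) :
    IntegrableOn (fun x : ℝ => x ^ (a - 1) * Real.exp (-(s * x))) (Ioi 0) := by
  have := integrableOn_rpow_mul_exp_neg_mul_rpow (p := 1) (s := a - 1) (b := s) (by linarith)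
    one_pos hs
  simpa [neg_mul] using this

lemma Iio_subset_integrableExpSet {a : ℝ} (ha : 0 < a) :
    Iio 0 ⊆ integrableExpSet id (powerMeasure a) := by
  intro z hz
  have hm : Measurable fun x : ℝ => Real.toNNReal (x ^ (a - 1)) := by fun_prop
  simp only [integrableExpSet, Set.mem_ofPred_eq, id, powerMeasure]
  rw [integrable_withDensity_iff_integrable_smul hm]
  refine (integrableOn_rpow_mul_exp_neg_mul ha (neg_pos.mpr hz)).congr_fun (fun x hx => ?_)
    measurableSet_Ioi
  simp only [NNReal.smul_def, Real.coe_toNNReal _ (Real.rpow_nonneg (le_of_lt hx) _), smul_eq_mul]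
  ring_nf

/-- The Laplace transform of `x ^ (a - 1)` on the right half-plane. -/
theorem integral_rpow_smul_cexp_neg_mul {a : ℝ} (ha : 0 < a) {t : ℂ} (ht : 0 < t.re) :
    ∫ x in Ioi (0 : ℝ), x ^ (a - 1) • Complex.exp (-t * x) =
      t ^ (-(a : ℂ)) * Real.Gamma a := by
  have hint : Iio 0 ⊆ interior (integrableExpSet id (powerMeasure a)) :=
    interior_maximal (Iio_subset_integrableExpSet ha) isOpen_Iio
  set U : Set ℂ := {z | z.re < 0} with hU
  have hUo : IsOpen U := isOpen_lt Complex.continuous_re continuous_const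
  have hUc : IsPreconnected U := (convex_halfSpace_re_lt 0).isPreconnected
  have h1 : AnalyticOnNhd ℂ (complexMGF id (powerMeasure a)) U :=
    analyticOnNhd_complexMGF.mono fun z hz => hint hz
  have h2 : AnalyticOnNhd ℂ (fun z : ℂ => (-z) ^ (-(a : ℂ)) * Real.Gamma a) U := by
    refine DifferentiableOn.analyticOnNhd (fun z hz => ?_) hUo
    refine DifferentiableAt.differentiableWithinAt ?_
    refine (DifferentiableAt.cpow (by fun_prop) (by fun_prop) ?_).mul_const _
    left
    simpa [hU] using hz
  have hreal : ∀ x : ℝ, x < 0 → complexMGF id (powerMeasure a) x =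
      (-(x : ℂ)) ^ (-(a : ℂ)) * Real.Gamma a := by
    intro x hx
    rw [complexMGF_ofReal, mgf, integral_powerMeasure]
    have := Real.integral_rpow_mul_exp_neg_mul_Ioi ha (neg_pos.mpr hx)
    simp only [neg_mul, neg_neg] at this
    simp only [smul_eq_mul, id, this]
    rw [one_div, Real.inv_rpow (neg_pos.mpr hx).le, ← Real.rpow_neg (neg_pos.mpr hx).le]
    push_cast [Complex.ofReal_cpow (neg_pos.mpr hx).le]
    rfl
  have hfreq : ∃ᶠ z in 𝓝[≠] ((-1 : ℝ) : ℂ), complexMGF id (powerMeasure a) z =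
      (-z) ^ (-(a : ℂ)) * Real.Gamma a := by
    have ht : Tendsto (fun x : ℝ => (x : ℂ)) (𝓝[≠] (-1)) (𝓝[≠] ((-1 : ℝ) : ℂ)) := by
      refine tendsto_nhdsWithin_of_tendsto_nhds_of_eventually_within _
        (Complex.continuous_ofReal.continuousAt.tendsto.mono_left nhdsWithin_le_nhds) ?_
      filter_upwards [self_mem_nhdsWithin] with x hx
      simpa only [mem_compl_iff, mem_singleton_iff, Complex.ofReal_inj] using hx
    refine ht.frequently (Eventually.frequently ?_)
    filter_upwards [mem_nhdsWithin_of_mem_nhds (Iio_mem_nhds (show (-1 : ℝ) < 0 by norm_num))]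
      with x hx using hreal x hx
  have h := h1.eqOn_of_preconnected_of_frequently_eq h2 hUc (show ((-1 : ℝ) : ℂ) ∈ U by simp [hU])
    hfreq (show -t ∈ U by simpa [hU] using ht)
  simp only [complexMGF, integral_powerMeasure, id, neg_neg] at h
  exact h

/-- The function `x ^ (a - 1) * exp (- s x)` supported on the positive half-line. -/
noncomputable def gammaKernel (a s : ℝ) : ℝ → ℂ :=
  indicator (Ioi 0) fun x => ((x ^ (a - 1) * Real.exp (-(s * x)) : ℝ) : ℂ)

lemma integrable_gammaKernel {a s : ℝ} (ha : 0 < a) (hs : 0 < s) :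
    Integrable (gammaKernel a s) := by
  rw [gammaKernel, integrable_indicator_iff measurableSet_Ioi]
  exact (integrableOn_rpow_mul_exp_neg_mul ha hs).ofReal

open FourierTransform in
lemma fourier_gammaKernel {a s : ℝ} (ha : 0 < a) (hs : 0 < s) (w : ℝ) :
    𝓕 (gammaKernel a s) w =
      ((s : ℂ) + (2 * Real.pi * w : ℝ) * Complex.I) ^ (-(a : ℂ)) * Real.Gamma a := by
  rw [← integral_rpow_smul_cexp_neg_mul ha (by simpa using hs),
    Real.fourier_real_eq_integral_exp_smul, ← integral_indicator measurableSet_Ioi]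
  congr 1
  ext x
  by_cases hx : x ∈ Ioi (0 : ℝ)
  · simp only [gammaKernel, indicator_of_mem hx, smul_eq_mul, Complex.real_smul]
    push_cast
    rw [mul_left_comm, ← Complex.exp_add]
    ring_nf
  · simp [gammaKernel, indicator_of_notMem hx]

lemma norm_cpow_neg_ofReal {t : ℂ} (ht : 0 < t.re) (a : ℝ) :
    ‖t ^ (-(a : ℂ))‖ = ‖t‖ ^ (-a) := by
  have ht0 : t ≠ 0 := fun h0 => by simp [h0] at ht
  rw [Complex.norm_cpow_of_ne_zero ht0]
  simp

lemma norm_add_mul_I_sq (s θ : ℝ) : ‖(s : ℂ) + θ * Complex.I‖ ^ 2 = s ^ 2 + θ ^ 2 := by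
  rw [← Complex.normSq_eq_norm_sq, Complex.normSq_add_mul_I]

lemma le_norm_add_mul_I (s θ : ℝ) : s ≤ ‖(s : ℂ) + θ * Complex.I‖ := by
  refine le_trans (le_trans (le_abs_self s) ?_) (Complex.abs_re_le_norm _)
  simp

lemma integrable_inv_sq_add_sq {s : ℝ} (hs : 0 < s) :
    Integrable fun θ : ℝ => (s ^ 2 + θ ^ 2)⁻¹ := by
  have := (integrable_inv_one_add_sq.comp_div hs.ne').const_mul ((s ^ 2)⁻¹)
  refine this.congr (Eventually.of_forall fun θ => ?_)
  have : 0 < s ^ 2 + θ ^ 2 := by positivity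
  simp only []
  field_simp

lemma integral_univ_inv_sq_add_sq {s : ℝ} (hs : 0 < s) :
    ∫ θ : ℝ, (s ^ 2 + θ ^ 2)⁻¹ = Real.pi / s := by
  have h : (fun θ : ℝ => (s ^ 2 + θ ^ 2)⁻¹) =
      fun θ => (s ^ 2)⁻¹ * (fun x : ℝ => (1 + x ^ 2)⁻¹) (θ / s) := by
    ext θ
    have : 0 < s ^ 2 + θ ^ 2 := by positivity
    simp only []
    field_simp
  rw [h, integral_const_mul, Measure.integral_comp_div (fun x : ℝ => (1 + x ^ 2)⁻¹) s,
    integral_univ_inv_one_add_sq, abs_of_pos hs, smul_eq_mul]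
  field_simp

lemma norm_cpow_neg_le {a s : ℝ} (ha : 2 ≤ a) (hs : 0 < s) (θ : ℝ) :
    ‖((s : ℂ) + θ * Complex.I) ^ (-(a : ℂ))‖ ≤ s ^ (2 - a) * (s ^ 2 + θ ^ 2)⁻¹ := by
  have hle := le_norm_add_mul_I s θ
  have hpos : 0 < ‖(s : ℂ) + θ * Complex.I‖ := hs.trans_le hle
  rw [norm_cpow_neg_ofReal (by simpa using hs), ← norm_add_mul_I_sq s θ,
    show -a = (2 - a) + (-2 : ℝ) by ring, Real.rpow_add hpos, Real.rpow_neg hpos.le (2 : ℝ)]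
  norm_cast
  refine mul_le_mul_of_nonneg_right ?_ (by positivity)
  exact Real.rpow_le_rpow_of_nonpos hs hle (sub_nonpos.mpr ha)

lemma continuous_cpow_add_mul_I {s : ℝ} (hs : 0 < s) (b : ℂ) :
    Continuous fun θ : ℝ => ((s : ℂ) + θ * Complex.I) ^ b := by
  refine Continuous.cpow (by fun_prop) continuous_const fun θ => ?_
  left
  simpa using hs

lemma integrable_cpow_neg {a s : ℝ} (ha : 2 ≤ a) (hs : 0 < s) :
    Integrable fun θ : ℝ => ((s : ℂ) + θ * Complex.I) ^ (-(a : ℂ)) :=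
  Integrable.mono' ((integrable_inv_sq_add_sq hs).const_mul (s ^ (2 - a)))
    (continuous_cpow_add_mul_I hs _).aestronglyMeasurable
    (Eventually.of_forall (norm_cpow_neg_le ha hs))

open FourierTransform in
/-- Inversion of the Laplace transform of a power. -/
theorem integral_cpow_neg_mul_exp {a s N : ℝ} (ha : 2 ≤ a) (hs : 0 < s) (hN : 0 < N) :
    ∫ θ : ℝ, ((s : ℂ) + θ * Complex.I) ^ (-(a : ℂ)) * Complex.exp (N * (s + θ * Complex.I)) =
      ((2 * Real.pi * N ^ (a - 1) / Real.Gamma a : ℝ) : ℂ) := by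
  have ha0 : 0 < a := by linarith
  have hΓ : 0 < Real.Gamma a := Real.Gamma_pos_of_pos ha0
  have hF : 𝓕 (gammaKernel a s) = fun w : ℝ =>
      ((s : ℂ) + (2 * Real.pi * w : ℝ) * Complex.I) ^ (-(a : ℂ)) * Real.Gamma a :=
    funext (fourier_gammaKernel ha0 hs)
  have hFi : Integrable (𝓕 (gammaKernel a s)) := by
    rw [hF]
    exact ((integrable_cpow_neg ha hs).comp_mul_left' (R := 2 * Real.pi)
      (by positivity)).mul_const _
  have hc : ContinuousAt (gammaKernel a s) N := by
    have : ContinuousAt (fun x : ℝ => ((x ^ (a - 1) * Real.exp (-(s * x)) : ℝ) : ℂ)) N := by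
      refine Complex.continuous_ofReal.continuousAt.comp ?_
      refine ContinuousAt.mul ?_ (by fun_prop)
      exact Real.continuousAt_rpow_const _ _ (Or.inl hN.ne')
    refine this.congr ?_
    filter_upwards [Ioi_mem_nhds hN] with x hx
    simp [gammaKernel, indicator_of_mem hx]
  have h := (integrable_gammaKernel ha0 hs).fourierInv_fourier_eq hFi hc
  rw [Real.fourierInv_eq', hF] at h
  have hsub := Measure.integral_comp_mul_left (fun θ : ℝ =>
    ((s : ℂ) + θ * Complex.I) ^ (-(a : ℂ)) * Complex.exp (N * (s + θ * Complex.I))) (2 * Real.pi)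
  have hlhs : ∫ w : ℝ, Complex.exp (↑(2 * Real.pi * inner ℝ w N) * Complex.I) •
      (((s : ℂ) + (2 * Real.pi * w : ℝ) * Complex.I) ^ (-(a : ℂ)) * Real.Gamma a) =
      Real.Gamma a * Complex.exp (-(N * s)) * ∫ w : ℝ,
        ((s : ℂ) + (2 * Real.pi * w : ℝ) * Complex.I) ^ (-(a : ℂ)) *
          Complex.exp (N * (s + (2 * Real.pi * w : ℝ) * Complex.I)) := by
    rw [← integral_const_mul]
    congr 1
    ext w
    have : Complex.exp (↑(2 * Real.pi * inner ℝ w N) * Complex.I) =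
        Complex.exp (-(N * s)) * Complex.exp (N * (s + (2 * Real.pi * w : ℝ) * Complex.I)) := by
      rw [← Complex.exp_add]
      simp only [RCLike.inner_apply, conj_trivial]
      push_cast
      ring_nf
    rw [this, smul_eq_mul]
    ring
  rw [hlhs, hsub, gammaKernel, indicator_of_mem (show N ∈ Ioi (0 : ℝ) from hN)] at h
  rw [Complex.real_smul, abs_of_pos (by positivity)] at h
  set J := ∫ θ : ℝ, ((s : ℂ) + θ * Complex.I) ^ (-(a : ℂ)) *
    Complex.exp (N * (s + θ * Complex.I))
  have hE : Complex.exp (-(N * s)) ≠ 0 := Complex.exp_ne_zero _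
  have hΓ' : (Real.Gamma a : ℂ) ≠ 0 := by exact_mod_cast hΓ.ne'
  have hpi : (Real.pi : ℂ) ≠ 0 := by exact_mod_cast Real.pi_ne_zero
  push_cast at h ⊢
  rw [mul_comm (s : ℂ) N] at h
  field_simp at h
  rw [eq_div_iff hΓ']
  linear_combination h

end Laplace

/-! ### The inverse Laplace transform of the main term -/

section MainIntegral

open MeasureTheory Filter Topology

/-- The function `√t (exp (A / t) - 1 - A / t - (A / t) ^ 2 / 2)`. -/
noncomputable def truncKernel (A : ℝ) (t : ℂ) : ℂ :=
  t ^ (2⁻¹ : ℂ) * (Complex.exp (A / t) - ∑ k ∈ Finset.range 3, (A / t) ^ k / (k.factorial : ℂ))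

lemma hasSum_truncKernel (A : ℝ) {t : ℂ} (ht : 0 < t.re) :
    HasSum (fun k : ℕ => ((A ^ (k + 3) / (k + 3).factorial : ℝ) : ℂ) *
      t ^ (-((k + 5 / 2 : ℝ) : ℂ))) (truncKernel A t) := by
  have ht0 : t ≠ 0 := fun h0 => by simp [h0] at ht
  have h := NormedSpace.expSeries_div_hasSum_exp ((A : ℂ) / t)
  rw [← Complex.exp_eq_exp_ℂ, ← hasSum_nat_add_iff' 3] at h
  refine (h.mul_left (t ^ (2⁻¹ : ℂ))).congr_fun ?_ |> fun h => h
  intro k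
  have : t ^ (-((k + 5 / 2 : ℝ) : ℂ)) = t ^ (2⁻¹ : ℂ) * (t ^ (k + 3))⁻¹ := by
    rw [← Complex.cpow_natCast, ← Complex.cpow_neg, ← Complex.cpow_add _ _ ht0]
    congr 1
    push_cast
    ring
  rw [this]
  push_cast
  rw [div_pow]
  field_simp

lemma factorial_mul_Gamma (k : ℕ) :
    ((k + 3).factorial : ℝ) * Real.Gamma (k + 5 / 2) =
      (k + 3) * (2 * k + 4).factorial * Real.sqrt Real.pi / 4 ^ (k + 2) := by
  have h := Real.Gamma_mul_Gamma_add_half (k + 5 / 2)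
  have h1 : Real.Gamma ((k : ℝ) + 5 / 2 + 1 / 2) = (k + 2).factorial := by
    rw [← Real.Gamma_nat_eq_factorial]
    congr 1
    push_cast
    ring
  have h2 : Real.Gamma (2 * ((k : ℝ) + 5 / 2)) = (2 * k + 4).factorial := by
    rw [← Real.Gamma_nat_eq_factorial]
    congr 1
    push_cast
    ring
  have h3 : (2 : ℝ) ^ (1 - 2 * ((k : ℝ) + 5 / 2)) = (4 ^ (k + 2))⁻¹ := by
    rw [show (4 : ℝ) = 2 ^ 2 by norm_num, ← pow_mul, ← Real.rpow_natCast, ← Real.rpow_neg (by norm_num)]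
    congr 1
    push_cast
    ring
  rw [h1, h2, h3] at h
  rw [Nat.factorial_succ]
  push_cast
  field_simp at h ⊢
  linear_combination ((k : ℝ) + 3) * h

lemma hasSum_mul_sinh_sub_cosh (u : ℝ) :
    HasSum (fun k : ℕ => u ^ (2 * (k + 3)) * (2 * k + 5) / (2 * (k + 3)).factorial)
      (u * Real.sinh u - Real.cosh u + 1 - u ^ 2 / 2 - u ^ 4 / 8) := by
  have hc := (hasSum_nat_add_iff' 3).mpr (Real.hasSum_cosh u)
  have hs := ((hasSum_nat_add_iff' 2).mpr (Real.hasSum_sinh u)).mul_left u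
  convert! hs.sub hc using 1
  · ext k
    rw [show 2 * (k + 3) = (2 * (k + 2) + 1) + 1 by ring, Nat.factorial_succ]
    push_cast
    field_simp
    ring
  · simp only [Finset.sum_range_succ, Finset.sum_range_zero, Nat.factorial]
    push_cast
    ring

lemma norm_truncKernel_term_le {A s N : ℝ} (hA : 0 < A) (hs : 0 < s) (k : ℕ) (θ : ℝ) :
    ‖((A ^ (k + 3) / (k + 3).factorial : ℝ) : ℂ) *
      ((s : ℂ) + θ * Complex.I) ^ (-((k + 5 / 2 : ℝ) : ℂ)) *
        Complex.exp (N * (s + θ * Complex.I))‖ ≤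
      (s ^ (5 / 2 : ℝ) * Real.exp (N * s)) * ((A / s) ^ (k + 3) / (k + 3).factorial) *
        (s ^ 2 + θ ^ 2)⁻¹ := by
  have h1 := norm_cpow_neg_le (a := k + 5 / 2) (by linarith [(Nat.cast_nonneg k : (0 : ℝ) ≤ k)])
    hs θ
  have h2 : s ^ (2 - ((k : ℝ) + 5 / 2)) = s ^ (5 / 2 : ℝ) / s ^ (k + 3) := by
    rw [← Real.rpow_natCast, ← Real.rpow_sub hs]
    congr 1
    push_cast
    ring
  rw [h2] at h1
  have h3 : ‖Complex.exp (N * (s + θ * Complex.I))‖ = Real.exp (N * s) := by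
    rw [Complex.norm_exp]
    simp
  rw [norm_mul, norm_mul, h3, Complex.norm_real, Real.norm_of_nonneg (by positivity)]
  calc A ^ (k + 3) / (k + 3).factorial * ‖((s : ℂ) + θ * Complex.I) ^ (-((k + 5 / 2 : ℝ) : ℂ))‖ *
        Real.exp (N * s) ≤ A ^ (k + 3) / (k + 3).factorial *
          (s ^ (5 / 2 : ℝ) / s ^ (k + 3) * (s ^ 2 + θ ^ 2)⁻¹) * Real.exp (N * s) := by gcongr
    _ = _ := by
      rw [div_pow]
      ring

/-- The inverse Laplace transform of `truncKernel` in closed form. -/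
theorem integral_truncKernel_mul_exp {A s N u : ℝ} (hA : 0 < A) (hs : 0 < s) (hN : 0 < N)
    (hu : u ^ 2 = 4 * A * N) :
    ∫ θ : ℝ, truncKernel A (s + θ * Complex.I) * Complex.exp (N * (s + θ * Complex.I)) =
      ((Real.sqrt Real.pi * N ^ (-(3 / 2) : ℝ) *
        (u * Real.sinh u - Real.cosh u + 1 - u ^ 2 / 2 - u ^ 4 / 8) : ℝ) : ℂ) := by
  set F : ℕ → ℝ → ℂ := fun k θ => ((A ^ (k + 3) / (k + 3).factorial : ℝ) : ℂ) *
      ((s : ℂ) + θ * Complex.I) ^ (-((k + 5 / 2 : ℝ) : ℂ)) *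
        Complex.exp (N * (s + θ * Complex.I)) with hF
  have hcont : ∀ k, Continuous (F k) := fun k =>
    ((continuous_const.mul (continuous_cpow_add_mul_I hs _))).mul (by fun_prop)
  have hint : ∀ k, Integrable (F k) := fun k =>
    Integrable.mono' ((integrable_inv_sq_add_sq hs).const_mul _)
      (hcont k).aestronglyMeasurable
      (Eventually.of_forall fun θ => norm_truncKernel_term_le hA hs k θ)
  have hsum : Summable fun k => ∫ θ, ‖F k θ‖ := by
    have h1 : Summable fun k : ℕ => (A / s) ^ (k + 3) / ((k + 3).factorial : ℝ) :=
      (summable_nat_add_iff 3).mpr (Real.summable_pow_div_factorial (A / s))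
    refine Summable.of_nonneg_of_le (fun k => integral_nonneg fun θ => norm_nonneg _)
      (fun k => ?_) ((h1.mul_left (s ^ (5 / 2 : ℝ) * Real.exp (N * s))).mul_right (Real.pi / s))
    rw [← integral_univ_inv_sq_add_sq hs, ← integral_const_mul]
    exact integral_mono (hint k).norm ((integrable_inv_sq_add_sq hs).const_mul _)
      fun θ => norm_truncKernel_term_le hA hs k θ
  have h := hasSum_integral_of_summable_integral_norm hint hsum
  have htsum : ∀ θ : ℝ, ∑' k, F k θ =
      truncKernel A (s + θ * Complex.I) * Complex.exp (N * (s + θ * Complex.I)) := fun θ =>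
    ((hasSum_truncKernel A (by simpa using hs)).mul_right _).tsum_eq
  simp only [htsum] at h
  refine h.unique ?_
  have hval : ∀ k, ∫ θ, F k θ = ((Real.sqrt Real.pi * N ^ (-(3 / 2) : ℝ) *
      (u ^ (2 * (k + 3)) * (2 * k + 5) / (2 * (k + 3)).factorial) : ℝ) : ℂ) := by
    intro k
    simp only [hF, mul_assoc]
    rw [integral_const_mul, integral_cpow_neg_mul_exp
      (by linarith [(Nat.cast_nonneg k : (0 : ℝ) ≤ k)]) hs hN, ← Complex.ofReal_mul]
    congr 1
    have hΓ : 0 < Real.Gamma (k + 5 / 2) := Real.Gamma_pos_of_pos (by positivity)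
    have hfΓ := factorial_mul_Gamma k
    have hpow : N ^ ((k : ℝ) + 5 / 2 - 1) = N ^ (k + 3) * N ^ (-(3 / 2) : ℝ) := by
      rw [← Real.rpow_natCast, ← Real.rpow_add hN]
      congr 1
      push_cast
      ring
    have hsq : Real.sqrt Real.pi * Real.sqrt Real.pi = Real.pi :=
      Real.mul_self_sqrt Real.pi_pos.le
    have hsq0 : 0 < Real.sqrt Real.pi := Real.sqrt_pos.mpr Real.pi_pos
    have hfac : ((2 * (k + 3)).factorial : ℝ) = (2 * k + 6) * (2 * k + 5) * (2 * k + 4).factorial := by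
      rw [show 2 * (k + 3) = (2 * k + 4) + 1 + 1 by ring, Nat.factorial_succ, Nat.factorial_succ]
      push_cast
      ring
    rw [hpow, pow_mul u, hu, hfac]
    rw [show A ^ (k + 3) / ((k + 3).factorial : ℝ) * (2 * Real.pi * (N ^ (k + 3) * N ^ (-(3 / 2) : ℝ)) /
      Real.Gamma (k + 5 / 2)) = A ^ (k + 3) * (2 * Real.pi * (N ^ (k + 3) * N ^ (-(3 / 2) : ℝ))) /
      ((k + 3).factorial * Real.Gamma (k + 5 / 2)) by field_simp, hfΓ, mul_pow, mul_pow]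
    field_simp
    rw [Real.sq_sqrt Real.pi_pos.le]
    ring
  simp only [hval]
  exact_mod_cast (hasSum_mul_sinh_sub_cosh u).mul_left _

lemma norm_truncKernel_le {A : ℝ} (hA : 0 < A) {t : ℂ} (ht : 0 < t.re) :
    ‖truncKernel A t‖ ≤ ‖t‖ ^ (2⁻¹ : ℝ) * ((A / ‖t‖) ^ 3 * Real.exp (A / ‖t‖)) := by
  have ht0 : t ≠ 0 := fun h0 => by simp [h0] at ht
  have h := Complex.norm_exp_sub_sum_le_norm_mul_exp ((A : ℂ) / t) 3
  rw [norm_div, Complex.norm_real, Real.norm_of_nonneg hA.le] at h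
  rw [truncKernel, norm_mul]
  gcongr
  rw [Complex.norm_cpow_of_ne_zero ht0]
  simp

end MainIntegral

/-! ### The asymptotic formula for the partition function -/

section Asymptotic

open MeasureTheory Filter Topology

lemma norm_cexp_mul_add_mul_I (N s θ : ℝ) :
    ‖Complex.exp (N * (s + θ * Complex.I))‖ = Real.exp (N * s) := by
  rw [Complex.norm_exp]
  simp

lemma inv_sqrt_two_pi_le : (Real.sqrt (2 * Real.pi))⁻¹ ≤ 1 / 2 := by
  rw [inv_le_comm₀ (by positivity) (by norm_num)]
  refine Real.le_sqrt_of_sq_le ?_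
  linarith [Real.pi_gt_three]

lemma norm_half_cpow {t : ℂ} (ht : 0 < t.re) : ‖t ^ (2⁻¹ : ℂ)‖ = Real.sqrt ‖t‖ := by
  have ht0 : t ≠ 0 := fun h0 => by simp [h0] at ht
  rw [Complex.norm_cpow_of_ne_zero ht0, Real.sqrt_eq_rpow]
  simp

/-- On the major arc the generating function is close to its main term. -/
lemma norm_eulerPhi_inv_sub_truncKernel_le (n : ℕ) {s θ : ℝ} (hs : 0 < s) (hs1 : s ≤ 1)
    (hθ : |θ| ≤ s) :
    ‖(eulerPhi (Complex.exp (-(s + θ * Complex.I))))⁻¹ * Complex.exp (n * (s + θ * Complex.I)) -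
      ((Real.sqrt (2 * Real.pi) : ℝ) : ℂ)⁻¹ * (truncKernel (Real.pi ^ 2 / 6) (s + θ * Complex.I) *
        Complex.exp (((n - 1 / 24 : ℝ) : ℂ) * (s + θ * Complex.I)))‖ ≤
      Real.exp ((n - 1 / 24) * s) *
        (5 + Real.pi ^ 2 / 6 / s + (Real.pi ^ 2 / 6 / s) ^ 2 / 2) := by
  set t : ℂ := s + θ * Complex.I with ht
  have hre : 0 < t.re := by simpa [ht] using hs
  have ht0 : t ≠ 0 := fun h0 => by simp [h0] at hre
  have hst : s ≤ ‖t‖ := le_norm_add_mul_I s θ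
  have hnt : ‖t‖ ≤ 2 := by
    calc ‖t‖ ≤ ‖(s : ℂ)‖ + ‖(θ : ℂ) * Complex.I‖ := norm_add_le _ _
      _ ≤ s + |θ| := by simp [abs_of_pos hs]
      _ ≤ 2 := by linarith
  have hpi := Real.pi_gt_three
  -- the real part of the reciprocal
  have hX : (1 : ℝ) / 2 ≤ (t⁻¹).re := by
    rw [Complex.inv_re, Complex.normSq_eq_norm_sq, ht, norm_add_mul_I_sq]
    simp only [Complex.add_re, Complex.ofReal_re, Complex.mul_re, Complex.I_re, mul_zero,
      Complex.ofReal_im, Complex.I_im, mul_one, sub_self, add_zero]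
    rw [le_div_iff₀ (by positivity)]
    nlinarith [sq_abs θ, abs_nonneg θ, sq_nonneg (s - 1)]
  set X := (t⁻¹).re with hXdef
  have hpi2 : (9 : ℝ) ≤ Real.pi ^ 2 := by nlinarith
  have hq : ‖Complex.exp (-(4 * Real.pi ^ 2 / t))‖ = Real.exp (-(4 * Real.pi ^ 2 * X)) := by
    rw [Complex.norm_exp, hXdef]
    congr 1
    rw [div_eq_mul_inv, Complex.neg_re,
      show (4 * (Real.pi : ℂ) ^ 2) = ((4 * Real.pi ^ 2 : ℝ) : ℂ) by push_cast; rfl,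
      Complex.re_ofReal_mul]
  have hexpA : ‖Complex.exp (((Real.pi ^ 2 / 6 : ℝ) : ℂ) / t)‖ =
      Real.exp (Real.pi ^ 2 / 6 * X) := by
    rw [Complex.norm_exp, hXdef, div_eq_mul_inv, Complex.re_ofReal_mul]
  set Q := (eulerPhi (Complex.exp (-(4 * Real.pi ^ 2 / t))))⁻¹ with hQ
  have hQ1 : ‖Q - 1‖ ≤ 4 * Real.exp (-(4 * Real.pi ^ 2 * X)) := by
    rw [← hq]
    refine norm_eulerPhi_inv_sub_one_le ?_
    rw [hq]
    exact exp_neg_le_of_ten_le (by nlinarith)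
  have hkey : (eulerPhi (Complex.exp (-t)))⁻¹ * Complex.exp (n * t) -
      ((Real.sqrt (2 * Real.pi) : ℝ) : ℂ)⁻¹ * (truncKernel (Real.pi ^ 2 / 6) t *
        Complex.exp (((n - 1 / 24 : ℝ) : ℂ) * t)) =
      ((Real.sqrt (2 * Real.pi) : ℝ) : ℂ)⁻¹ * t ^ (2⁻¹ : ℂ) *
        Complex.exp (((n - 1 / 24 : ℝ) : ℂ) * t) *
        (Complex.exp (((Real.pi ^ 2 / 6 : ℝ) : ℂ) / t) * (Q - 1) +
          (1 + ((Real.pi ^ 2 / 6 : ℝ) : ℂ) / t + (((Real.pi ^ 2 / 6 : ℝ) : ℂ) / t) ^ 2 / 2)) := by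
    have he : Complex.exp ((Real.pi : ℂ) ^ 2 / 6 / t - t / 24) * Complex.exp (n * t) =
        Complex.exp (((Real.pi ^ 2 / 6 : ℝ) : ℂ) / t) *
          Complex.exp (((n - 1 / 24 : ℝ) : ℂ) * t) := by
      rw [← Complex.exp_add, ← Complex.exp_add]
      congr 1
      push_cast
      ring
    rw [eulerPhi_inv_modular hre, ← hQ, truncKernel]
    simp only [Finset.sum_range_succ, Finset.sum_range_zero, Nat.factorial]
    push_cast at he ⊢
    linear_combination ((Real.sqrt (2 * Real.pi) : ℝ) : ℂ)⁻¹ * t ^ (2⁻¹ : ℂ) * Q * he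
  rw [hkey, norm_mul, norm_mul, norm_mul, ht, norm_cexp_mul_add_mul_I, ← ht, norm_half_cpow hre,
    norm_inv, Complex.norm_real, Real.norm_of_nonneg (Real.sqrt_nonneg _)]
  have h1 : (Real.sqrt (2 * Real.pi))⁻¹ * Real.sqrt ‖t‖ ≤ 1 := by
    have : Real.sqrt ‖t‖ ≤ 2 := Real.sqrt_le_iff.mpr ⟨by norm_num, by linarith⟩
    nlinarith [inv_sqrt_two_pi_le, Real.sqrt_nonneg ‖t‖]
  have hAt : ‖((Real.pi ^ 2 / 6 : ℝ) : ℂ) / t‖ ≤ Real.pi ^ 2 / 6 / s := by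
    rw [norm_div, Complex.norm_real, Real.norm_of_nonneg (by positivity)]
    gcongr
  have h2 : ‖Complex.exp (((Real.pi ^ 2 / 6 : ℝ) : ℂ) / t) * (Q - 1) +
      (1 + ((Real.pi ^ 2 / 6 : ℝ) : ℂ) / t + (((Real.pi ^ 2 / 6 : ℝ) : ℂ) / t) ^ 2 / 2)‖ ≤
      5 + Real.pi ^ 2 / 6 / s + (Real.pi ^ 2 / 6 / s) ^ 2 / 2 := by
    have h3 : ‖Complex.exp (((Real.pi ^ 2 / 6 : ℝ) : ℂ) / t) * (Q - 1)‖ ≤ 4 := by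
      rw [norm_mul, hexpA]
      calc Real.exp (Real.pi ^ 2 / 6 * X) * ‖Q - 1‖ ≤
          Real.exp (Real.pi ^ 2 / 6 * X) * (4 * Real.exp (-(4 * Real.pi ^ 2 * X))) := by gcongr
        _ = 4 * Real.exp (Real.pi ^ 2 / 6 * X + -(4 * Real.pi ^ 2 * X)) := by
          rw [Real.exp_add]
          ring
        _ ≤ 4 * 1 := by
          gcongr
          rw [Real.exp_le_one_iff]
          nlinarith
        _ = 4 := by norm_num
    have h4 : ‖(((Real.pi ^ 2 / 6 : ℝ) : ℂ) / t) ^ 2 / 2‖ ≤ (Real.pi ^ 2 / 6 / s) ^ 2 / 2 := by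
      rw [norm_div, norm_pow, Complex.norm_ofNat]
      gcongr
    calc _ ≤ _ := norm_add_le _ _
      _ ≤ 4 + ((1 + Real.pi ^ 2 / 6 / s) + (Real.pi ^ 2 / 6 / s) ^ 2 / 2) := by
        refine add_le_add h3 ((norm_add_le _ _).trans (add_le_add ((norm_add_le _ _).trans ?_) h4))
        rw [norm_one]
        exact add_le_add le_rfl hAt
      _ = _ := by ring
  have h5 := mul_le_mul (mul_le_mul_of_nonneg_right h1 (Real.exp_pos ((n - 1 / 24) * s)).le) h2
    (norm_nonneg _) (by positivity)
  rwa [one_mul] at h5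

lemma norm_truncKernel_mul_exp_le {A s : ℝ} (N θ : ℝ) (hA : 0 < A) (hs : 0 < s) (hs1 : s ≤ 1) :
    ‖((Real.sqrt (2 * Real.pi) : ℝ) : ℂ)⁻¹ * (truncKernel A (s + θ * Complex.I) *
        Complex.exp ((N : ℂ) * (s + θ * Complex.I)))‖ ≤
      A ^ 3 / s * Real.exp (A / ‖(s : ℂ) + θ * Complex.I‖ + N * s) * (s ^ 2 + θ ^ 2)⁻¹ := by
  set t : ℂ := s + θ * Complex.I with ht
  have hre : 0 < t.re := by simpa [ht] using hs
  have hst : s ≤ ‖t‖ := le_norm_add_mul_I s θ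
  have ht2 : ‖t‖ ^ 2 = s ^ 2 + θ ^ 2 := norm_add_mul_I_sq s θ
  have htpos : 0 < ‖t‖ := hs.trans_le hst
  rw [norm_mul, norm_mul, ht, norm_cexp_mul_add_mul_I, ← ht, norm_inv, Complex.norm_real,
    Real.norm_of_nonneg (Real.sqrt_nonneg _)]
  have hG := norm_truncKernel_le hA hre
  have h1 : ‖t‖ ^ (2⁻¹ : ℝ) ≤ ‖t‖ / s := by
    rw [le_div_iff₀ hs, show (2⁻¹ : ℝ) = 1 / 2 by norm_num, ← Real.sqrt_eq_rpow]
    have h2 := Real.mul_self_sqrt htpos.le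
    have h3 : s ≤ Real.sqrt ‖t‖ := Real.le_sqrt_of_sq_le (by nlinarith)
    nlinarith [Real.sqrt_nonneg ‖t‖]
  have h3 : (Real.sqrt (2 * Real.pi))⁻¹ ≤ 1 := by linarith [inv_sqrt_two_pi_le]
  rw [← ht2, Real.exp_add]
  calc (Real.sqrt (2 * Real.pi))⁻¹ * (‖truncKernel A t‖ * Real.exp (N * s)) ≤
      1 * ((‖t‖ / s * ((A / ‖t‖) ^ 3 * Real.exp (A / ‖t‖))) * Real.exp (N * s)) := by
        gcongr
        exact hG.trans (by gcongr)
    _ = _ := by field_simp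

lemma norm_truncKernel_tail_le {A s θ : ℝ} (N : ℝ) (hA : 0 < A) (hs : 0 < s) (hs1 : s ≤ 1)
    (hθ : s ≤ |θ|) :
    ‖((Real.sqrt (2 * Real.pi) : ℝ) : ℂ)⁻¹ * (truncKernel A (s + θ * Complex.I) *
        Complex.exp ((N : ℂ) * (s + θ * Complex.I)))‖ ≤
      A ^ 3 / s * Real.exp (3 / 4 * (A / s) + N * s) * (s ^ 2 + θ ^ 2)⁻¹ := by
  refine (norm_truncKernel_mul_exp_le N θ hA hs hs1).trans ?_
  have htpos : 0 < ‖(s : ℂ) + θ * Complex.I‖ := hs.trans_le (le_norm_add_mul_I s θ)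
  have ht34 : 4 / 3 * s ≤ ‖(s : ℂ) + θ * Complex.I‖ := by
    refine le_of_sq_le_sq ?_ htpos.le
    rw [norm_add_mul_I_sq]
    nlinarith [sq_abs θ, abs_nonneg θ]
  gcongr
  rw [div_le_iff₀ htpos]
  calc A = 3 / 4 * (A / s) * (4 / 3 * s) := by field_simp
    _ ≤ _ := by gcongr

lemma integrable_truncKernel_mul_exp {A s : ℝ} (N : ℝ) (hA : 0 < A) (hs : 0 < s) (hs1 : s ≤ 1) :
    Integrable fun θ : ℝ => ((Real.sqrt (2 * Real.pi) : ℝ) : ℂ)⁻¹ *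
      (truncKernel A (s + θ * Complex.I) * Complex.exp ((N : ℂ) * (s + θ * Complex.I))) := by
  refine Integrable.mono' (g := fun θ => A ^ 3 / s * Real.exp (A / s + N * s) *
    (s ^ 2 + θ ^ 2)⁻¹) ((integrable_inv_sq_add_sq hs).const_mul _)
    (Continuous.aestronglyMeasurable ?_) (Eventually.of_forall fun θ => ?_)
  · have h0 : ∀ θ : ℝ, (s : ℂ) + θ * Complex.I ≠ 0 := fun θ h => by
      have := congrArg Complex.re h
      simp [hs.ne'] at this
    have hd : Continuous fun θ : ℝ => (A : ℂ) / (s + θ * Complex.I) :=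
      continuous_const.div (by fun_prop) h0
    simp only [truncKernel]
    exact continuous_const.mul (((continuous_cpow_add_mul_I hs _).mul
      (by fun_prop)).mul (by fun_prop))
  · refine (norm_truncKernel_mul_exp_le N θ hA hs hs1).trans ?_
    have := le_norm_add_mul_I s θ
    gcongr

lemma one_le_partitionFun (n : ℕ) : 1 ≤ partitionFun n :=
  Fintype.card_pos

/-- The partition numbers with an explicit main term and error term, from the circle method. -/
theorem abs_partitionFun_sub_le (n : ℕ) {s u : ℝ} (hs : 0 < s) (hs1 : s ≤ 1)
    (hN : (0 : ℝ) < n - 1 / 24) (hu : u ^ 2 = 4 * (Real.pi ^ 2 / 6) * (n - 1 / 24)) :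
    |2 * Real.pi * partitionFun n - (Real.sqrt (2 * Real.pi))⁻¹ *
      (Real.sqrt Real.pi * ((n : ℝ) - 1 / 24) ^ (-(3 / 2) : ℝ) *
        (u * Real.sinh u - Real.cosh u + 1 - u ^ 2 / 2 - u ^ 4 / 8))| ≤
      2 * Real.pi * (Real.exp ((n - 1 / 24) * s) *
        (5 + Real.pi ^ 2 / 6 / s + (Real.pi ^ 2 / 6 / s) ^ 2 / 2) +
        2 * Real.exp (Real.pi ^ 2 / 6 / s - 3 / 20 / s + 1) * Real.exp (n * s)) +
      (Real.pi ^ 2 / 6) ^ 3 / s *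
        Real.exp (3 / 4 * (Real.pi ^ 2 / 6 / s) + (n - 1 / 24) * s) * (Real.pi / s) := by
  have hA : (0 : ℝ) < Real.pi ^ 2 / 6 := by positivity
  have hpi := Real.pi_gt_three
  set P : ℝ → ℂ := fun θ => (eulerPhi (Complex.exp (-(s + θ * Complex.I))))⁻¹ *
    Complex.exp (n * (s + θ * Complex.I)) with hP
  set M : ℝ → ℂ := fun θ => ((Real.sqrt (2 * Real.pi) : ℝ) : ℂ)⁻¹ *
    (truncKernel (Real.pi ^ 2 / 6) (s + θ * Complex.I) *
      Complex.exp (((n - 1 / 24 : ℝ) : ℂ) * (s + θ * Complex.I))) with hM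
  set B₁ := Real.exp ((n - 1 / 24) * s) *
    (5 + Real.pi ^ 2 / 6 / s + (Real.pi ^ 2 / 6 / s) ^ 2 / 2)
  set B₂ := 2 * Real.exp (Real.pi ^ 2 / 6 / s - 3 / 20 / s + 1) * Real.exp (n * s)
  set B₃ := (Real.pi ^ 2 / 6) ^ 3 / s *
    Real.exp (3 / 4 * (Real.pi ^ 2 / 6 / s) + (n - 1 / 24) * s)
  have hB₁ : 0 ≤ B₁ := by positivity
  have hB₂ : 0 ≤ B₂ := by positivity
  have hB₃ : 0 ≤ B₃ := by positivity
  have hMint : Integrable M := integrable_truncKernel_mul_exp _ hA hs hs1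
  have hMval : ∫ θ, M θ = (((Real.sqrt (2 * Real.pi))⁻¹ *
      (Real.sqrt Real.pi * ((n : ℝ) - 1 / 24) ^ (-(3 / 2) : ℝ) *
        (u * Real.sinh u - Real.cosh u + 1 - u ^ 2 / 2 - u ^ 4 / 8)) : ℝ) : ℂ) := by
    simp only [hM]
    rw [integral_const_mul, integral_truncKernel_mul_exp hA hs hN hu]
    push_cast
    rfl
  have hPval : ∫ θ in (-Real.pi)..Real.pi, P θ = 2 * Real.pi * partitionFun n :=
    integral_eulerPhi_inv n hs
  have hle : -Real.pi ≤ Real.pi := by linarith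
  have hPint : IntegrableOn P (Set.Ioc (-Real.pi) Real.pi) := by
    by_contra hcon
    rw [← intervalIntegrable_iff_integrableOn_Ioc_of_le hle] at hcon
    rw [intervalIntegral.integral_undef hcon] at hPval
    have : (partitionFun n : ℂ) ≠ 0 :=
      Nat.cast_ne_zero.mpr (Nat.one_le_iff_ne_zero.mp (one_le_partitionFun n))
    have hpi' : (Real.pi : ℂ) ≠ 0 := by exact_mod_cast Real.pi_ne_zero
    simp [this, hpi'] at hPval
  rw [intervalIntegral.integral_of_le hle] at hPval
  have hdiff : ∫ θ, ((Set.Ioc (-Real.pi) Real.pi).indicator P θ - M θ) =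
      ((2 * Real.pi * partitionFun n - (Real.sqrt (2 * Real.pi))⁻¹ *
      (Real.sqrt Real.pi * ((n : ℝ) - 1 / 24) ^ (-(3 / 2) : ℝ) *
        (u * Real.sinh u - Real.cosh u + 1 - u ^ 2 / 2 - u ^ 4 / 8)) : ℝ) : ℂ) := by
    rw [integral_sub ((integrable_indicator_iff measurableSet_Ioc).mpr hPint) hMint,
      integral_indicator measurableSet_Ioc, hPval, hMval, Complex.ofReal_sub]
    congr 1
    push_cast
    rfl
  have hbound : ∀ θ, ‖(Set.Ioc (-Real.pi) Real.pi).indicator P θ - M θ‖ ≤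
      (Set.Ioc (-Real.pi) Real.pi).indicator (fun _ => B₁ + B₂) θ + B₃ * (s ^ 2 + θ ^ 2)⁻¹ := by
    intro θ
    have hnn : 0 ≤ B₃ * (s ^ 2 + θ ^ 2)⁻¹ := by positivity
    rcases le_total |θ| s with h | h
    · have hmem : θ ∈ Set.Ioc (-Real.pi) Real.pi := by
        rw [abs_le] at h
        exact ⟨by linarith, by linarith⟩
      rw [Set.indicator_of_mem hmem, Set.indicator_of_mem hmem]
      have : ‖P θ - M θ‖ ≤ B₁ := norm_eulerPhi_inv_sub_truncKernel_le n hs hs1 h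
      linarith
    · have hM3 : ‖M θ‖ ≤ B₃ * (s ^ 2 + θ ^ 2)⁻¹ := norm_truncKernel_tail_le _ hA hs hs1 h
      refine (norm_sub_le _ _).trans (add_le_add ?_ hM3)
      by_cases hmem : θ ∈ Set.Ioc (-Real.pi) Real.pi
      · rw [Set.indicator_of_mem hmem, Set.indicator_of_mem hmem]
        have h2 : ‖P θ‖ ≤ B₂ := by
          simp only [hP]
          rw [norm_mul, show (n : ℂ) = ((n : ℝ) : ℂ) by simp, norm_cexp_mul_add_mul_I]
          exact mul_le_mul_of_nonneg_right
            (norm_eulerPhi_inv_minor_le hs hs1 h (abs_le.mpr ⟨hmem.1.le, hmem.2⟩))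
            (Real.exp_pos _).le
        linarith
      · simp [Set.indicator_of_notMem hmem]
  have hbi : Integrable ((Set.Ioc (-Real.pi) Real.pi).indicator fun _ => B₁ + B₂) := by
    rw [integrable_indicator_iff measurableSet_Ioc]
    exact integrableOn_const (by simp)
  have hbi' := (integrable_inv_sq_add_sq hs).const_mul B₃
  have h := norm_integral_le_of_norm_le (hbi.add hbi') (Eventually.of_forall hbound)
  rw [hdiff, Complex.norm_real, Real.norm_eq_abs] at h
  refine h.trans (le_of_eq ?_)
  rw [integral_add' hbi hbi', integral_indicator measurableSet_Ioc, integral_const_mul,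
    integral_univ_inv_sq_add_sq hs, setIntegral_const, smul_eq_mul]
  congr 2
  rw [measureReal_def, Real.volume_Ioc, ENNReal.toReal_ofReal (by linarith)]
  ring

end Asymptotic

section MainTerm

/-- The main term of the partition function in the variable `u = √(cconst * (n - 1 / 24))`. -/
noncomputable def partitionMain (u : ℝ) : ℝ :=
  cconst ^ (3 / 2 : ℝ) / (4 * Real.sqrt 2 * Real.pi) * ((u - 1) / u ^ 3) * Real.exp u

lemma six_le_cconst : 6 ≤ cconst := by
  rw [cconst]
  nlinarith [Real.pi_gt_three]

lemma cconst_le_seven : cconst ≤ 7 := by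
  rw [cconst]
  nlinarith [Real.pi_lt_d2, Real.pi_gt_three]

lemma four_le_cconst_rpow_div : 4 ≤ cconst ^ (3 / 2 : ℝ) / Real.sqrt 2 := by
  have hc := six_le_cconst
  have h2 : Real.sqrt 2 ≤ 3 / 2 := Real.sqrt_le_iff.mpr ⟨by norm_num, by norm_num⟩
  rw [le_div_iff₀ (by positivity)]
  calc 4 * Real.sqrt 2 ≤ 6 ^ (1 : ℝ) := by rw [Real.rpow_one]; linarith
    _ ≤ cconst ^ (1 : ℝ) := by gcongr
    _ ≤ cconst ^ (3 / 2 : ℝ) := Real.rpow_le_rpow_of_exponent_le (by linarith) (by norm_num)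

lemma cconst_rpow_div_le : cconst ^ (3 / 2 : ℝ) / Real.sqrt 2 ≤ 49 := by
  have hc := six_le_cconst
  have h2 : 1 ≤ Real.sqrt 2 := Real.le_sqrt_of_sq_le (by norm_num)
  calc cconst ^ (3 / 2 : ℝ) / Real.sqrt 2 ≤ cconst ^ (3 / 2 : ℝ) :=
        div_le_self (by positivity) h2
    _ ≤ cconst ^ (2 : ℝ) := Real.rpow_le_rpow_of_exponent_le (by linarith) (by norm_num)
    _ ≤ 49 := by
      norm_cast
      nlinarith [cconst_le_seven]

lemma eleven_mul_pow_four_le_exp {u : ℝ} (hu : 10 ^ 10 ≤ u) :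
    11 * u ^ 4 ≤ Real.exp (u / 100) := by
  refine le_trans ?_ (Real.pow_div_factorial_le_exp (u / 100) (by linarith) 6)
  have h6 : ((Nat.factorial 6 : ℕ) : ℝ) = 720 := by norm_num [Nat.factorial]
  rw [h6, div_pow, show u ^ 6 = u ^ 4 * u ^ 2 by ring]
  have h4 : 0 ≤ u ^ 4 := by positivity
  have : 11 * (720 * 100 ^ 6) ≤ u ^ 2 := by nlinarith
  rw [le_div_iff₀ (by norm_num), le_div_iff₀ (by norm_num)]
  nlinarith

set_option maxHeartbeats 1000000 in
/-- An asymptotic formula for `p(n)` with an exponentially small relative error. -/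
theorem abs_partitionFun_sub_main_le (n : ℕ) {u : ℝ} (hu : 10 ^ 10 ≤ u)
    (hun : u ^ 2 = cconst * (n - 1 / 24)) :
    |partitionFun n - partitionMain u| ≤ partitionMain u * Real.exp (-(u / 30)) := by
  have hpi := Real.pi_gt_three
  have hpi' := Real.pi_lt_d2
  have hu0 : 0 < u := by linarith
  have hu2 : 10 ^ 10 * u ≤ u ^ 2 := by nlinarith
  have hc := six_le_cconst
  have hpi2 : Real.pi ^ 2 ≤ 9.9225 := by nlinarith
  have hN : (0 : ℝ) < n - 1 / 24 := by
    have : 0 < cconst * (n - 1 / 24) := by rw [← hun]; positivity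
    exact pos_of_mul_pos_right this (by linarith)
  set N : ℝ := n - 1 / 24 with hNdef
  set s : ℝ := Real.pi ^ 2 / 3 / u with hs
  have hs0 : 0 < s := by positivity
  have hs1 : s ≤ 1 := by
    rw [hs, div_le_one hu0]
    linarith
  have hun' : u ^ 2 = 4 * (Real.pi ^ 2 / 6) * N := by rw [hun, cconst]; ring
  have hAs : Real.pi ^ 2 / 6 / s = u / 2 := by
    rw [hs]
    field_simp
    norm_num
  have hNs : N * s = u / 2 := by
    rw [hs]
    field_simp
    linear_combination -(3 : ℝ) * hun'
  have h := abs_partitionFun_sub_le n hs0 hs1 hN hun'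
  set K := cconst ^ (3 / 2 : ℝ) / Real.sqrt 2 with hK
  have hK4 : 4 ≤ K := four_le_cconst_rpow_div
  have hK49 : K ≤ 49 := cconst_rpow_div_le
  have hconst : (Real.sqrt (2 * Real.pi))⁻¹ * (Real.sqrt Real.pi * N ^ (-(3 / 2) : ℝ) *
      (u * Real.sinh u - Real.cosh u + 1 - u ^ 2 / 2 - u ^ 4 / 8)) =
      K / u ^ 3 * ((u - 1) * Real.exp u / 2 - (u + 1) * Real.exp (-u) / 2 + 1 - u ^ 2 / 2 -
        u ^ 4 / 8) := by
    have hNu : N = u ^ 2 / cconst := by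
      rw [hun]
      field_simp
    have hNp : N ^ (-(3 / 2) : ℝ) = cconst ^ (3 / 2 : ℝ) / u ^ 3 := by
      rw [hNu, Real.rpow_neg (by positivity), Real.div_rpow (by positivity) (by positivity),
        inv_div]
      congr 1
      rw [← Real.rpow_natCast u 2, ← Real.rpow_mul hu0.le, ← Real.rpow_natCast u 3]
      norm_num
    rw [hNp, Real.sinh_eq, Real.cosh_eq, Real.sqrt_mul (by norm_num), hK]
    have : 0 < Real.sqrt Real.pi := by positivity
    field_simp
    ring
  rw [hconst] at h
  have hmain : 2 * Real.pi * partitionMain u = K / u ^ 3 * ((u - 1) * Real.exp u / 2) := by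
    rw [partitionMain, hK]
    field_simp
    ring
  set E := Real.exp (191 / 200 * u) with hE
  have hE1 : 1 ≤ E := Real.one_le_exp (by positivity)
  have hR1 : 2 * Real.pi * (Real.exp (N * s) *
      (5 + Real.pi ^ 2 / 6 / s + (Real.pi ^ 2 / 6 / s) ^ 2 / 2)) ≤ 7 * u ^ 2 * E := by
    rw [hAs, hNs]
    have h1 : Real.exp (u / 2) ≤ E := Real.exp_le_exp.mpr (by linarith)
    have h2 : 5 + u / 2 + (u / 2) ^ 2 / 2 ≤ u ^ 2 := by linarith
    have h3 : 0 ≤ 5 + u / 2 + (u / 2) ^ 2 / 2 := by positivity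
    calc 2 * Real.pi * (Real.exp (u / 2) * (5 + u / 2 + (u / 2) ^ 2 / 2)) ≤
        7 * (E * u ^ 2) := by gcongr; linarith
      _ = _ := by ring
  have hR2 : 2 * Real.pi * (2 * Real.exp (Real.pi ^ 2 / 6 / s - 3 / 20 / s + 1) *
      Real.exp (n * s)) ≤ u ^ 2 * E := by
    have h1 : 9 / 200 * u ≤ 3 / 20 / s := by
      rw [le_div_iff₀ hs0, hs, mul_comm, div_mul_eq_mul_div, div_le_iff₀ hu0]
      have := mul_le_mul_of_nonneg_right hpi2 hu0.le
      linarith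
    have h2 : n * s = u / 2 + s / 24 := by rw [← hNs, hNdef]; ring
    rw [mul_assoc 2 (Real.exp _), ← Real.exp_add, hAs, h2]
    have h3 : Real.exp (u / 2 - 3 / 20 / s + 1 + (u / 2 + s / 24)) ≤ Real.exp 2 * E := by
      rw [hE, ← Real.exp_add]
      exact Real.exp_le_exp.mpr (by linarith)
    have h4 : Real.exp 2 ≤ 9 := by
      rw [show (2 : ℝ) = 1 + 1 by norm_num, Real.exp_add]
      have := mul_le_mul Real.exp_one_lt_d9.le Real.exp_one_lt_d9.le (Real.exp_pos 1).le
        (by norm_num)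
      linarith
    calc 2 * Real.pi * (2 * Real.exp (u / 2 - 3 / 20 / s + 1 + (u / 2 + s / 24))) ≤
        2 * 3.15 * (2 * (9 * E)) := by
          gcongr
          exact h3.trans (by gcongr)
      _ = 113.4 * E := by ring
      _ ≤ u ^ 2 * E := by
        have : 113.4 ≤ u ^ 2 := by linarith
        gcongr
  have hR3 : (Real.pi ^ 2 / 6) ^ 3 / s * Real.exp (3 / 4 * (Real.pi ^ 2 / 6 / s) + N * s) *
      (Real.pi / s) ≤ 2 * u ^ 2 * E := by
    have h1 : (Real.pi ^ 2 / 6) ^ 3 / s * Real.exp (3 / 4 * (Real.pi ^ 2 / 6 / s) + N * s) *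
      (Real.pi / s) = (Real.pi * (Real.pi ^ 2 / 6)) * (Real.pi ^ 2 / 6 / s) ^ 2 *
        Real.exp (3 / 4 * (Real.pi ^ 2 / 6 / s) + N * s) := by
      field_simp
    rw [h1, hAs, hNs]
    have h2 : Real.exp (3 / 4 * (u / 2) + u / 2) ≤ E := Real.exp_le_exp.mpr (by linarith)
    have h3 : Real.pi * (Real.pi ^ 2 / 6) ≤ 8 := by
      have := mul_le_mul hpi'.le hpi2 (sq_nonneg _) (by norm_num)
      linarith
    calc Real.pi * (Real.pi ^ 2 / 6) * (u / 2) ^ 2 * Real.exp (3 / 4 * (u / 2) + u / 2) ≤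
        8 * (u / 2) ^ 2 * E := by gcongr
      _ = _ := by ring
  have hR4 : |K / u ^ 3 * (-((u + 1) * Real.exp (-u) / 2) + 1 - u ^ 2 / 2 - u ^ 4 / 8)| ≤
      u ^ 2 * E := by
    have h1 : Real.exp (-u) ≤ 1 := Real.exp_le_one_iff.mpr (by linarith)
    have h0 := Real.exp_pos (-u)
    have h2 : |-((u + 1) * Real.exp (-u) / 2) + 1 - u ^ 2 / 2 - u ^ 4 / 8| ≤ u ^ 4 := by
      rw [abs_le]
      have h3 : 0 ≤ (u + 1) * Real.exp (-u) / 2 := by positivity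
      have h4 : (u + 1) * Real.exp (-u) / 2 ≤ (u + 1) * 1 / 2 := by gcongr
      have h5 : 10 ≤ u ^ 2 := by linarith
      have h6 : u + 1 ≤ u ^ 2 := by linarith
      have h7 : 10 * u ^ 2 ≤ u ^ 4 := by
        have := mul_le_mul_of_nonneg_right h5 (sq_nonneg u)
        linarith
      constructor <;> linarith
    rw [abs_mul, abs_of_pos (by positivity)]
    calc K / u ^ 3 * _ ≤ 49 / u ^ 3 * u ^ 4 := by gcongr
      _ = 49 * u := by field_simp
      _ ≤ u ^ 2 * 1 := by linarith
      _ ≤ u ^ 2 * E := by gcongr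
  have hlow : 11 * u ^ 2 * E ≤ K / u ^ 3 * ((u - 1) * Real.exp u / 2) * Real.exp (-(u / 30)) := by
    have h1 : Real.exp u * Real.exp (-(u / 30)) = E * Real.exp (7 / 600 * u) := by
      rw [hE, ← Real.exp_add, ← Real.exp_add]
      congr 1
      ring
    have h2 : 11 * u ^ 4 ≤ Real.exp (7 / 600 * u) :=
      (eleven_mul_pow_four_le_exp hu).trans (Real.exp_le_exp.mpr (by linarith))
    calc 11 * u ^ 2 * E = 4 / u ^ 3 * (u / 2 / 2) * (E * (11 * u ^ 4)) := by
          field_simp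
          norm_num
      _ ≤ K / u ^ 3 * ((u - 1) / 2) * (E * Real.exp (7 / 600 * u)) := by
          have h3 : u / 2 ≤ u - 1 := by linarith
          have h4 : 0 ≤ K / u ^ 3 * ((u - 1) / 2) :=
            mul_nonneg (by positivity) (by linarith)
          gcongr
      _ = K / u ^ 3 * ((u - 1) * Real.exp u / 2) * Real.exp (-(u / 30)) := by
          rw [← h1]
          ring
  have hfin : |2 * Real.pi * partitionFun n - 2 * Real.pi * partitionMain u| ≤
      2 * Real.pi * partitionMain u * Real.exp (-(u / 30)) := by
    rw [hmain]
    refine le_trans ?_ hlow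
    rw [abs_le] at h hR4 ⊢
    have hsplit : K / u ^ 3 * ((u - 1) * Real.exp u / 2 - (u + 1) * Real.exp (-u) / 2 + 1 -
        u ^ 2 / 2 - u ^ 4 / 8) = K / u ^ 3 * ((u - 1) * Real.exp u / 2) +
        K / u ^ 3 * (-((u + 1) * Real.exp (-u) / 2) + 1 - u ^ 2 / 2 - u ^ 4 / 8) := by ring
    rw [hsplit, mul_add (2 * Real.pi)] at h
    constructor <;> linarith [h.1, h.2, hR4.1, hR4.2]
  rw [← mul_sub, abs_mul, abs_of_pos (by positivity), mul_assoc (2 * Real.pi)] at hfin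
  exact le_of_mul_le_mul_left hfin (by positivity)

end MainTerm

section Taylor

open Filter Topology

lemma iteratedDeriv_eq_re_of_ofReal {F : ℂ → ℂ} {f : ℝ → ℝ} {ρ : ℝ}
    (hF : ∀ z, ‖z‖ < ρ → DifferentiableAt ℂ F z) (hFf : ∀ x : ℝ, |x| < ρ → F x = f x) (r : ℕ) :
    ∀ x : ℝ, |x| < ρ → iteratedDeriv r f x = (iteratedDeriv r F x).re := by
  have hFo : DifferentiableOn ℂ F (Metric.ball 0 ρ) := fun z hz =>
    (hF z (by simpa using hz)).differentiableWithinAt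
  induction r with
  | zero =>
    intro x hx
    simp [hFf x hx]
  | succ r ih =>
    intro x hx
    have hev : iteratedDeriv r f =ᶠ[𝓝 x] fun y : ℝ => (iteratedDeriv r F y).re := by
      filter_upwards [(isOpen_lt continuous_abs continuous_const).mem_nhds hx] with y hy
      exact ih y hy
    have hd : DifferentiableAt ℂ (iteratedDeriv r F) x := by
      have ha : AnalyticAt ℂ F x := hFo.analyticAt
        (Metric.isOpen_ball.mem_nhds (by simpa using hx))
      rw [iteratedDeriv_eq_iterate]
      exact (ha.iterated_deriv r).differentiableAt
    rw [iteratedDeriv_succ, iteratedDeriv_succ, hev.deriv_eq]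
    exact hd.hasDerivAt.real_of_complex.deriv

/-- Cauchy estimates bound the remainder of the Taylor polynomial of a real function which extends
to a bounded holomorphic function on a disc. -/
theorem abs_sub_taylor_le {F : ℂ → ℂ} {f : ℝ → ℝ} {ρ B : ℝ} (hρ : 0 < ρ)
    (hF : ∀ z, ‖z‖ ≤ ρ → DifferentiableAt ℂ F z) (hB : ∀ z, ‖z‖ ≤ ρ → ‖F z‖ ≤ B)
    (hFf : ∀ x : ℝ, |x| < ρ → F x = f x) (K : ℕ) {x : ℝ} (hx0 : 0 ≤ x) (hx : x ≤ ρ / 2) :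
    |f x - ∑ r ∈ Finset.range K, iteratedDeriv r f 0 / (r.factorial : ℝ) * x ^ r| ≤
      2 * B * (x / ρ) ^ K := by
  have hB0 : 0 ≤ B := (norm_nonneg _).trans (hB 0 (by simpa using hρ.le))
  have hxρ : |x| < ρ := by rw [abs_of_nonneg hx0]; linarith
  have hFo : DifferentiableOn ℂ F (Metric.ball 0 ρ) := fun z hz =>
    (hF z (by simpa using (Metric.mem_ball.mp hz).le)).differentiableWithinAt
  have hFc : DiffContOnCl ℂ F (Metric.ball 0 ρ) := by
    apply DifferentiableOn.diffContOnCl_ball (U := Metric.closedBall 0 ρ) _ subset_rfl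
    intro z hz
    exact (hF z (by simpa using hz)).differentiableWithinAt
  set q := x / ρ with hq
  have hq0 : 0 ≤ q := by positivity
  have hq1 : q ≤ 1 / 2 := by rw [hq, div_le_iff₀ hρ]; linarith
  have hs := Complex.hasSum_taylorSeries_on_ball hFo (z := (x : ℂ)) (by simpa using hxρ)
  set a : ℕ → ℂ := fun n => ((n.factorial : ℂ))⁻¹ • ((x : ℂ) - 0) ^ n • iteratedDeriv n F 0 with ha
  have hterm : ∀ n, ‖a n‖ ≤ B * q ^ n := by
    intro n
    have h1 := Complex.norm_iteratedDeriv_le_of_forall_mem_sphere_norm_le n hρ hFc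
      (fun z hz => hB z (by simpa using (mem_sphere_zero_iff_norm.mp hz).le))
    have h2 : ‖a n‖ = (n.factorial : ℝ)⁻¹ * (x ^ n * ‖iteratedDeriv n F 0‖) := by
      simp [ha, abs_of_nonneg hx0]
    rw [h2]
    calc (n.factorial : ℝ)⁻¹ * (x ^ n * ‖iteratedDeriv n F 0‖) ≤
        (n.factorial : ℝ)⁻¹ * (x ^ n * (n.factorial * B / ρ ^ n)) := by gcongr
      _ = B * q ^ n := by
        rw [hq, div_pow]
        field_simp
  have hs2 : HasSum (fun n => a (n + K)) (F x - ∑ r ∈ Finset.range K, a r) :=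
    (hasSum_nat_add_iff' K).mpr hs
  have hg : HasSum (fun n => B * q ^ K * q ^ n) (B * q ^ K * (1 - q)⁻¹) :=
    (hasSum_geometric_of_lt_one hq0 (by linarith)).mul_left _
  have hle : ‖F x - ∑ r ∈ Finset.range K, a r‖ ≤ B * q ^ K * (1 - q)⁻¹ := by
    rw [← hs2.tsum_eq]
    refine tsum_of_norm_bounded hg fun n => (hterm _).trans_eq ?_
    ring
  have hre : f x - ∑ r ∈ Finset.range K, iteratedDeriv r f 0 / (r.factorial : ℝ) * x ^ r =
      (F x - ∑ r ∈ Finset.range K, a r).re := by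
    rw [Complex.sub_re, hFf x hxρ, Complex.ofReal_re, Complex.re_sum]
    congr 1
    refine Finset.sum_congr rfl fun r _ => ?_
    rw [iteratedDeriv_eq_re_of_ofReal (fun z hz => hF z hz.le) hFf r 0 (by simpa using hρ)]
    have : a r = (((r.factorial : ℝ)⁻¹ * x ^ r : ℝ) : ℂ) * iteratedDeriv r F 0 := by
      simp [ha]
      ring
    rw [this, Complex.re_ofReal_mul, Complex.ofReal_zero]
    ring
  rw [hre]
  refine (Complex.abs_re_le_norm _).trans (hle.trans ?_)
  have h3 : (1 - q)⁻¹ ≤ 2 := by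
    rw [inv_le_comm₀ (by linarith) (by norm_num)]
    linarith
  calc B * q ^ K * (1 - q)⁻¹ ≤ B * q ^ K * 2 := by gcongr
    _ = _ := by ring

end Taylor

section ComplexExtension

/-- The branch of `√(1 + z)` which is holomorphic near `z = 0`. -/
noncomputable def sqrtOneAdd (z : ℂ) : ℂ := Complex.exp (Complex.log (1 + z) / 2)

lemma one_add_mem_slitPlane {z : ℂ} (hz : ‖z‖ ≤ 1 / 100) : 1 + z ∈ Complex.slitPlane := by
  refine Or.inl ?_
  have := (abs_le.mp (Complex.abs_re_le_norm z)).1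
  simp only [Complex.add_re, Complex.one_re]
  linarith

lemma differentiableAt_sqrtOneAdd {z : ℂ} (hz : ‖z‖ ≤ 1 / 100) :
    DifferentiableAt ℂ sqrtOneAdd z := by
  unfold sqrtOneAdd
  have h := one_add_mem_slitPlane hz
  exact (((differentiableAt_const _).add differentiableAt_id).clog h).div_const 2 |>.cexp

lemma sqrtOneAdd_sq {z : ℂ} (hz : ‖z‖ ≤ 1 / 100) : sqrtOneAdd z ^ 2 = 1 + z := by
  rw [sqrtOneAdd, ← Complex.exp_nat_mul]
  have : ((2 : ℕ) : ℂ) * (Complex.log (1 + z) / 2) = Complex.log (1 + z) := by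
    push_cast
    ring
  rw [this, Complex.exp_log (Complex.slitPlane_ne_zero (one_add_mem_slitPlane hz))]

lemma norm_sqrtOneAdd_mem {z : ℂ} (hz : ‖z‖ ≤ 1 / 100) :
    99 / 100 ≤ ‖sqrtOneAdd z‖ ∧ ‖sqrtOneAdd z‖ ≤ 101 / 100 := by
  have h := congrArg norm (sqrtOneAdd_sq hz)
  rw [norm_pow] at h
  have h1 : ‖1 + z‖ ≤ 1 + ‖z‖ := (norm_add_le _ _).trans_eq (by simp)
  have h2 : 1 - ‖z‖ ≤ ‖1 + z‖ := by
    have := norm_sub_norm_le (1 : ℂ) (-z)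
    simpa using this
  have h0 := norm_nonneg (sqrtOneAdd z)
  constructor <;> nlinarith

lemma one_le_norm_one_add_sqrtOneAdd (z : ℂ) : 1 ≤ ‖1 + sqrtOneAdd z‖ := by
  have h1 : 0 ≤ (sqrtOneAdd z).re := by
    rw [sqrtOneAdd, Complex.exp_re]
    refine mul_nonneg (Real.exp_nonneg _) (Real.cos_nonneg_of_mem_Icc ?_)
    have h2 : (Complex.log (1 + z) / 2).im = Complex.arg (1 + z) / 2 := by
      simp [Complex.log_im]
    rw [h2]
    constructor <;> linarith [Complex.arg_le_pi (1 + z), Complex.neg_pi_lt_arg (1 + z)]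
  refine le_trans ?_ (Complex.re_le_norm _)
  simpa using h1

lemma sqrtOneAdd_ofReal {x : ℝ} (hx : 0 < 1 + x) :
    sqrtOneAdd x = (Real.sqrt (1 + x) : ℝ) := by
  rw [sqrtOneAdd, ← Complex.ofReal_one, ← Complex.ofReal_add, ← Complex.ofReal_log hx.le,
    Real.sqrt_eq_rpow, Real.rpow_def_of_pos hx]
  push_cast
  congr 1
  ring

/-- The holomorphic extension of `Rfun j` to a neighbourhood of the origin. -/
noncomputable def complexRfun (j : ℕ) (w : ℂ) : ℂ :=
  Complex.exp (cconst * j * w / (1 + sqrtOneAdd (cconst * j * w ^ 2))) *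
      (sqrtOneAdd (cconst * j * w ^ 2) - w) /
    ((1 - w) * sqrtOneAdd (cconst * j * w ^ 2) ^ 3)

lemma norm_le_of_le_radius {d j : ℕ} (hd : 2 ≤ d) (hj : j ≤ d) {w : ℂ}
    (hw : ‖w‖ ≤ 1 / (4 * cconst * d)) :
    ‖w‖ ≤ 1 / 48 ∧ ‖(cconst * j * w : ℂ)‖ ≤ 1 / 4 ∧ ‖(cconst * j * w ^ 2 : ℂ)‖ ≤ 1 / 100 := by
  have hc := six_le_cconst
  have hd' : (2 : ℝ) ≤ d := by exact_mod_cast hd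
  have hj' : (j : ℝ) ≤ d := by exact_mod_cast hj
  have h12 : 12 ≤ cconst * d := by nlinarith
  have h1 : ‖w‖ ≤ 1 / 48 := by
    refine hw.trans (one_div_le_one_div_of_le (by norm_num) ?_)
    linarith
  have h2 : ‖(cconst * j * w : ℂ)‖ ≤ 1 / 4 := by
    rw [norm_mul, norm_mul, Complex.norm_natCast, Complex.norm_real, Real.norm_eq_abs,
      abs_of_nonneg (by linarith)]
    calc cconst * j * ‖w‖ ≤ cconst * d * (1 / (4 * cconst * d)) := by gcongr
      _ = 1 / 4 := by field_simp
  refine ⟨h1, h2, ?_⟩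
  have h3 : (cconst * j * w ^ 2 : ℂ) = cconst * j * w * w := by ring
  rw [h3, norm_mul]
  calc _ ≤ (1 / 4 : ℝ) * (1 / 48) := by gcongr
    _ ≤ _ := by norm_num

lemma one_sub_ne_zero_of_norm_le {w : ℂ} (hw : ‖w‖ ≤ 1 / 48) : 47 / 48 ≤ ‖1 - w‖ := by
  have := norm_sub_norm_le (1 : ℂ) w
  rw [norm_one] at this
  linarith

lemma differentiableAt_complexRfun {d j : ℕ} (hd : 2 ≤ d) (hj : j ≤ d) {w : ℂ}
    (hw : ‖w‖ ≤ 1 / (4 * cconst * d)) : DifferentiableAt ℂ (complexRfun j) w := by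
  obtain ⟨h1, -, h3⟩ := norm_le_of_le_radius hd hj hw
  have hS : DifferentiableAt ℂ (fun w : ℂ => sqrtOneAdd (cconst * j * w ^ 2)) w :=
    DifferentiableAt.comp (g := sqrtOneAdd) (f := fun w : ℂ => (cconst * j * w ^ 2 : ℂ)) w
      (differentiableAt_sqrtOneAdd h3) (by fun_prop)
  have hn1 : 1 + sqrtOneAdd (cconst * j * w ^ 2) ≠ 0 :=
    norm_pos_iff.mp (by linarith [one_le_norm_one_add_sqrtOneAdd (cconst * j * w ^ 2)])
  have hn2 : sqrtOneAdd (cconst * j * w ^ 2) ≠ 0 := Complex.exp_ne_zero _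
  have hn3 : 1 - w ≠ 0 := norm_pos_iff.mp (by linarith [one_sub_ne_zero_of_norm_le h1])
  have hn4 : (1 - w) * sqrtOneAdd (cconst * j * w ^ 2) ^ 3 ≠ 0 := mul_ne_zero hn3 (pow_ne_zero _ hn2)
  unfold complexRfun
  have hE : DifferentiableAt ℂ
      (fun w : ℂ => cconst * j * w / (1 + sqrtOneAdd (cconst * j * w ^ 2))) w :=
    DifferentiableAt.div (by fun_prop) (by fun_prop) hn1
  exact DifferentiableAt.div (by fun_prop) (by fun_prop) hn4

lemma norm_complexRfun_le {d j : ℕ} (hd : 2 ≤ d) (hj : j ≤ d) {w : ℂ}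
    (hw : ‖w‖ ≤ 1 / (4 * cconst * d)) : ‖complexRfun j w‖ ≤ 2 := by
  obtain ⟨h1, h2, h3⟩ := norm_le_of_le_radius hd hj hw
  obtain ⟨h4, h5⟩ := norm_sqrtOneAdd_mem h3
  have h6 := one_le_norm_one_add_sqrtOneAdd (cconst * j * w ^ 2)
  have h7 := one_sub_ne_zero_of_norm_le h1
  rw [complexRfun, norm_div, norm_mul, norm_mul, norm_pow]
  set S := sqrtOneAdd (cconst * j * w ^ 2)
  have hexp : ‖Complex.exp (cconst * j * w / (1 + S))‖ ≤ 13 / 10 := by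
    rw [Complex.norm_exp]
    have h8 : (cconst * j * w / (1 + S)).re ≤ 1 / 4 := by
      refine (Complex.re_le_norm _).trans ?_
      rw [norm_div]
      exact (div_le_self (norm_nonneg _) h6).trans h2
    refine (Real.exp_le_exp.mpr h8).trans ?_
    have h9 := Real.exp_bound' (x := 1 / 4) (by norm_num) (by norm_num) (n := 3) (by norm_num)
    refine h9.trans ?_
    norm_num [Finset.sum_range_succ, Nat.factorial]
  have hnum : ‖S - w‖ ≤ 104 / 100 := (norm_sub_le _ _).trans (by linarith)
  have hden : (47 / 48 : ℝ) * (99 / 100) ^ 3 ≤ ‖1 - w‖ * ‖S‖ ^ 3 := by gcongr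
  have hden0 : (0 : ℝ) < 47 / 48 * (99 / 100) ^ 3 := by norm_num
  rw [div_le_iff₀ (hden0.trans_le hden)]
  calc _ ≤ (13 / 10 : ℝ) * (104 / 100) := by gcongr
    _ ≤ 2 * (47 / 48 * (99 / 100) ^ 3) := by norm_num
    _ ≤ _ := by gcongr

lemma complexRfun_ofReal (j : ℕ) (x : ℝ) : complexRfun j x = (Rfun j x : ℝ) := by
  have hc : 0 ≤ cconst := by linarith [six_le_cconst]
  have h0 : 0 ≤ cconst * j * x ^ 2 := by positivity
  have h1 : (0 : ℝ) < 1 + cconst * j * x ^ 2 := by linarith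
  have h2 : (cconst * j * (x : ℂ) ^ 2 : ℂ) = ((cconst * j * x ^ 2 : ℝ) : ℂ) := by push_cast; ring
  have h3 : (1 + cconst * j * x ^ 2) ^ ((3 : ℝ) / 2) = Real.sqrt (1 + cconst * j * x ^ 2) ^ 3 := by
    rw [Real.sqrt_eq_rpow, ← Real.rpow_mul_natCast h1.le]
    norm_num
  rw [complexRfun, Rfun, h2, sqrtOneAdd_ofReal h1, h3]
  push_cast
  rfl

/-- The Taylor remainder of a product of functions `Rfun j` with `j ≤ d`. -/
theorem abs_prod_Rfun_sub_taylor_le {ι : Type*} [Fintype ι] {d : ℕ} (hd : 2 ≤ d) (j : ι → ℕ)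
    (hj : ∀ k, j k ≤ d) (K : ℕ) {x : ℝ} (hx0 : 0 ≤ x) (hx : x ≤ 1 / (8 * cconst * d)) :
    |∏ k, Rfun (j k) x - ∑ r ∈ Finset.range K,
        iteratedDeriv r (fun y : ℝ => ∏ k, Rfun (j k) y) 0 / (r.factorial : ℝ) * x ^ r| ≤
      2 * 2 ^ Fintype.card ι * (4 * cconst * d * x) ^ K := by
  have hc := six_le_cconst
  have hd' : (2 : ℝ) ≤ d := by exact_mod_cast hd
  have hρ : 0 < 1 / (4 * cconst * d) := by positivity
  have h := abs_sub_taylor_le (F := fun z => ∏ k, complexRfun (j k) z)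
    (f := fun y => ∏ k, Rfun (j k) y) (B := 2 ^ Fintype.card ι) hρ
    (fun z hz => DifferentiableAt.fun_finsetProd fun k _ => differentiableAt_complexRfun hd (hj k) hz)
    (fun z hz => by
      rw [norm_prod]
      refine (Finset.prod_le_prod (fun _ _ => norm_nonneg _)
        fun k _ => norm_complexRfun_le hd (hj k) hz).trans_eq ?_
      simp)
    (fun y _ => by
      rw [Complex.ofReal_prod]
      exact Finset.prod_congr rfl fun k _ => complexRfun_ofReal _ _) K hx0
    (hx.trans_eq (by field_simp; norm_num))
  refine h.trans_eq ?_
  congr 2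
  field_simp

lemma abs_Rfun_le {d j : ℕ} (hd : 2 ≤ d) (hj : j ≤ d) {x : ℝ}
    (hx : |x| ≤ 1 / (4 * cconst * d)) : |Rfun j x| ≤ 2 := by
  have := norm_complexRfun_le hd hj (w := x) (by simpa using hx)
  rwa [complexRfun_ofReal, Complex.norm_real] at this

end ComplexExtension

section Ratio

lemma partitionMain_pos {u : ℝ} (hu : 1 < u) : 0 < partitionMain u := by
  have hc : 0 < cconst := by linarith [six_le_cconst]
  have h1 : 0 < u - 1 := by linarith
  have h0 : 0 < u := by linarith
  unfold partitionMain
  positivity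

lemma partitionMain_mul_sqrt (j : ℕ) {u : ℝ} (hu : 1 < u) :
    partitionMain (u * Real.sqrt (1 + cconst * j * (1 / u) ^ 2)) =
      Rfun j (1 / u) * partitionMain u := by
  have hc : 0 ≤ cconst := by linarith [six_le_cconst]
  have h0 : 0 < u := by linarith
  have h1 : u - 1 ≠ 0 := by linarith
  have hz : (0 : ℝ) < 1 + cconst * j * (1 / u) ^ 2 := by positivity
  have h3 : (1 + cconst * j * (1 / u) ^ 2) ^ ((3 : ℝ) / 2) =
      Real.sqrt (1 + cconst * j * (1 / u) ^ 2) ^ 3 := by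
    rw [Real.sqrt_eq_rpow, ← Real.rpow_mul_natCast hz.le]
    norm_num
  have hs2 := Real.sq_sqrt hz.le
  have hs0 := Real.sqrt_pos.mpr hz
  rw [Rfun, h3]
  set s := Real.sqrt (1 + cconst * j * (1 / u) ^ 2)
  have hexp : Real.exp (u * s) =
      Real.exp (cconst * j * (1 / u) / (1 + s)) * Real.exp u := by
    rw [← Real.exp_add]
    congr 1
    have h4 : cconst * j * (1 / u) = u * (s ^ 2 - 1) := by
      rw [hs2]
      field_simp
      ring
    rw [h4]
    field_simp
    ring
  have hrat : (u * s - 1) / (u * s) ^ 3 =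
      (s - 1 / u) / ((1 - 1 / u) * s ^ 3) * ((u - 1) / u ^ 3) := by
    have h5 : 1 - 1 / u ≠ 0 := by
      rw [show 1 - 1 / u = (u - 1) / u by field_simp]
      exact div_ne_zero h1 h0.ne'
    field_simp
  rw [partitionMain, partitionMain, hexp, hrat]
  ring

lemma Rfun_pos (j : ℕ) {u : ℝ} (hu : 1 < u) : 0 < Rfun j (1 / u) := by
  have h := partitionMain_mul_sqrt j hu
  have hc : 0 ≤ cconst := by linarith [six_le_cconst]
  have h1 : 1 ≤ Real.sqrt (1 + cconst * j * (1 / u) ^ 2) := by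
    rw [Real.one_le_sqrt]
    have : 0 ≤ cconst * j * (1 / u) ^ 2 := by positivity
    linarith
  have h2 : 1 < u * Real.sqrt (1 + cconst * j * (1 / u) ^ 2) := by nlinarith
  have h3 := partitionMain_pos h2
  rw [h] at h3
  exact (pos_iff_pos_of_mul_pos h3).mpr (partitionMain_pos hu)

/-- The quotient `p(n + j) / p(n)` is `Rfun j (wfun n)` up to a tiny relative error. -/
theorem abs_partitionFun_div_sub_Rfun_le (n j : ℕ) {u : ℝ} (hu : 10 ^ 10 ≤ u)
    (hun : u ^ 2 = cconst * (n - 1 / 24)) :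
    |(partitionFun (n + j) : ℝ) / partitionFun n - Rfun j (1 / u)| ≤
      Rfun j (1 / u) * (4 * Real.exp (-(u / 30))) := by
  have hc : 0 ≤ cconst := by linarith [six_le_cconst]
  have h1 : 1 < u := by linarith
  have h0 : 0 < u := by linarith
  have hz : (1 : ℝ) ≤ 1 + cconst * j * (1 / u) ^ 2 := by
    have : 0 ≤ cconst * j * (1 / u) ^ 2 := by positivity
    linarith
  have hs2 := Real.sq_sqrt (zero_le_one.trans hz)
  have hs1 := Real.one_le_sqrt.mpr hz
  have hmul := partitionMain_mul_sqrt j h1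
  set s := Real.sqrt (1 + cconst * j * (1 / u) ^ 2)
  have husu : u ≤ u * s := le_mul_of_one_le_right h0.le hs1
  have hus : (u * s) ^ 2 = cconst * (((n + j : ℕ) : ℝ) - 1 / 24) := by
    have h2 : u ^ 2 * s ^ 2 = u ^ 2 + cconst * j := by
      rw [hs2]
      field_simp
    rw [mul_pow, h2, hun]
    push_cast
    ring
  have hR := Rfun_pos j h1
  have hM := partitionMain_pos h1
  have hj := abs_partitionFun_sub_main_le (n + j) (hu.trans husu) hus
  have hn := abs_partitionFun_sub_main_le n hu hun
  rw [hmul] at hj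
  set R := Rfun j (1 / u)
  set M := partitionMain u
  set e := Real.exp (-(u / 30))
  have he : Real.exp (-(u * s / 30)) ≤ e := Real.exp_le_exp.mpr (by linarith)
  have he0 : 0 < e := Real.exp_pos _
  have he2 : e ≤ 1 / 2 := by
    have h2 : (2 : ℝ) ≤ Real.exp (u / 30) := by
      linarith [Real.add_one_le_exp (u / 30)]
    have h3 : e = (Real.exp (u / 30))⁻¹ := Real.exp_neg _
    rw [h3, one_div]
    exact inv_anti₀ (by norm_num) h2
  have hj' : |(partitionFun (n + j) : ℝ) - R * M| ≤ R * M * e :=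
    hj.trans (mul_le_mul_of_nonneg_left he (by positivity))
  have hp : M / 2 ≤ partitionFun n := by
    have h4 := (abs_le.mp hn).1
    have h5 : M * e ≤ M * (1 / 2) := by gcongr
    linarith
  have hp0 : (0 : ℝ) < partitionFun n := by linarith
  have hdiv : (partitionFun (n + j) : ℝ) / partitionFun n - R =
      (partitionFun (n + j) - R * partitionFun n) / partitionFun n := by
    field_simp
  rw [hdiv, abs_div, abs_of_pos hp0, div_le_iff₀ hp0]
  have h6 : |(partitionFun (n + j) : ℝ) - R * partitionFun n| ≤ R * M * e + R * (M * e) := by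
    have h7 : (partitionFun (n + j) : ℝ) - R * partitionFun n =
        (partitionFun (n + j) - R * M) - R * (partitionFun n - M) := by ring
    rw [h7]
    refine (abs_sub _ _).trans (add_le_add hj' ?_)
    rw [abs_mul, abs_of_pos hR]
    gcongr
  refine h6.trans ?_
  calc R * M * e + R * (M * e) = R * (4 * e) * (M / 2) := by ring
    _ ≤ _ := by gcongr

theorem abs_prod_partitionFun_div_sub_le {ι : Type*} [Fintype ι] {d : ℕ} (hd : 2 ≤ d) (j : ι → ℕ)
    (hj : ∀ k, j k ≤ d) (n : ℕ) {u : ℝ} (hu : 10 ^ 10 ≤ u) (hud : 4 * cconst * d ≤ u)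
    (hun : u ^ 2 = cconst * (n - 1 / 24))
    (hsmall : 4 * Fintype.card ι * Real.exp (-(u / 30)) ≤ 1) :
    |∏ k, ((partitionFun (n + j k) : ℝ) / partitionFun n) - ∏ k, Rfun (j k) (1 / u)| ≤
      2 ^ Fintype.card ι * (8 * Fintype.card ι * Real.exp (-(u / 30))) := by
  have hc := six_le_cconst
  have hd' : (2 : ℝ) ≤ d := by exact_mod_cast hd
  have h1 : 1 < u := by linarith
  have hR : ∀ k, 0 < Rfun (j k) (1 / u) := fun k => Rfun_pos (j k) h1
  have hR2 : ∀ k, Rfun (j k) (1 / u) ≤ 2 := fun k => by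
    refine (le_abs_self _).trans (abs_Rfun_le hd (hj k) ?_)
    rw [abs_of_pos (by positivity)]
    exact one_div_le_one_div_of_le (by positivity) hud
  set η : ι → ℝ := fun k =>
    (partitionFun (n + j k) : ℝ) / partitionFun n / Rfun (j k) (1 / u) - 1 with hη
  have hηle : ∀ k, ‖η k‖ ≤ 4 * Real.exp (-(u / 30)) := by
    intro k
    have h2 := abs_partitionFun_div_sub_Rfun_le n (j k) hu hun
    have h3 : η k = ((partitionFun (n + j k) : ℝ) / partitionFun n - Rfun (j k) (1 / u)) /
        Rfun (j k) (1 / u) := by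
      rw [sub_div, div_self (hR k).ne']
    rw [h3, norm_div, Real.norm_eq_abs, Real.norm_eq_abs, abs_of_pos (hR k), div_le_iff₀ (hR k)]
    linarith
  have hsum : ∑ k, ‖η k‖ ≤ 4 * Fintype.card ι * Real.exp (-(u / 30)) := by
    refine (Finset.sum_le_sum fun k _ => hηle k).trans_eq ?_
    rw [Finset.sum_const, Finset.card_univ, nsmul_eq_mul]
    ring
  have hsum0 : 0 ≤ ∑ k, ‖η k‖ := Finset.sum_nonneg fun _ _ => norm_nonneg _
  have hprod : ∏ k, ((partitionFun (n + j k) : ℝ) / partitionFun n) - ∏ k, Rfun (j k) (1 / u) =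
      (∏ k, Rfun (j k) (1 / u)) * (∏ k, (1 + η k) - 1) := by
    rw [mul_sub, mul_one, ← Finset.prod_mul_distrib]
    congr 1
    refine Finset.prod_congr rfl fun k _ => ?_
    have := (hR k).ne'
    simp only [hη, add_sub_cancel]
    field_simp
  have h4 := Finset.norm_prod_one_add_sub_one_le Finset.univ η
  have h5 := (le_abs_self _).trans (Real.abs_exp_sub_one_le (x := ∑ k, ‖η k‖)
    (by rw [abs_of_nonneg hsum0]; linarith))
  rw [abs_of_nonneg hsum0] at h5
  rw [hprod, abs_mul]
  have h6 : |∏ k, Rfun (j k) (1 / u)| ≤ 2 ^ Fintype.card ι := by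
    rw [abs_of_pos (Finset.prod_pos fun k _ => hR k)]
    refine (Finset.prod_le_prod (fun k _ => (hR k).le) fun k _ => hR2 k).trans_eq ?_
    simp
  have h7 : |∏ k, (1 + η k) - 1| ≤ 8 * Fintype.card ι * Real.exp (-(u / 30)) := by
    rw [Real.norm_eq_abs] at h4
    linarith
  gcongr

end Ratio

section Numerics

lemma exp_neg_div_le_pow {u y : ℝ} {L : ℕ} (hyu : y ^ 4 ≤ u) (hu : 10 ^ 10 ≤ u)
    (hL : (L : ℝ) ≤ y) : Real.exp (-(u / 30)) ≤ (1 / u) ^ L := by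
  have h0 : 0 < u := by linarith
  have hlog := Real.log_le_rpow_div h0.le (ε := 1 / 4) (by norm_num)
  set v := u ^ (1 / 4 : ℝ) with hv
  have hv0 : 0 ≤ v := by positivity
  have hv4 : v ^ 4 = u := by
    rw [hv, ← Real.rpow_mul_natCast h0.le]
    norm_num
  have hyv : y ≤ v := by
    rw [← hv4] at hyu
    exact le_of_pow_le_pow_left₀ (by norm_num) hv0 hyu
  have hv100 : 100 ≤ v := by
    refine le_of_pow_le_pow_left₀ (n := 4) (by norm_num) hv0 ?_
    rw [hv4]
    linarith
  rw [one_div, inv_pow, Real.exp_neg]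
  refine inv_anti₀ (by positivity) ?_
  rw [← Real.rpow_natCast, Real.rpow_def_of_pos h0]
  refine Real.exp_le_exp.mpr ?_
  have hlog0 : Real.log u ≤ 4 * v := by linarith
  calc Real.log u * L ≤ 4 * v * v := by
        gcongr
        exact hL.trans hyv
    _ ≤ v ^ 4 / 30 := by nlinarith [mul_self_nonneg v, mul_nonneg hv0 hv0]
    _ = u / 30 := by rw [hv4]

lemma two_pow_mul_le {d N : ℕ} (hd : 2 ≤ d) (hN : N ≤ 2 * d - 2) :
    (2 : ℝ) ^ N * (2 + 8 * N) ≤ 2 * Real.exp 2 * (3 * d : ℝ) ^ (10 * d - 10) := by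
  obtain ⟨k, rfl⟩ : ∃ k, d = k + 2 := ⟨d - 2, by omega⟩
  have hN' : N ≤ 2 * (k + 1) := by omega
  have hNr : (N : ℝ) ≤ 2 * (k + 1) := by exact_mod_cast hN'
  have h1 : (2 : ℝ) ^ N ≤ 4 ^ (k + 1) := by
    rw [show (4 : ℝ) = 2 ^ 2 by norm_num, ← pow_mul]
    exact pow_le_pow_right₀ (by norm_num) hN'
  have h2 : (k : ℝ) + 1 ≤ 2 ^ (k + 1) := by exact_mod_cast (Nat.lt_two_pow_self (n := k + 1)).le
  have h3 : (9 : ℝ) ≤ 9 ^ (k + 1) := le_self_pow₀ (by norm_num) (by omega)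
  have h4 : (6 : ℝ) ^ (10 * (k + 1)) ≤ (3 * ((k + 2 : ℕ) : ℝ)) ^ (10 * (k + 2) - 10) := by
    rw [show 10 * (k + 2) - 10 = 10 * (k + 1) by omega]
    refine pow_le_pow_left₀ (by norm_num) ?_ _
    push_cast
    linarith [(Nat.cast_nonneg k : (0 : ℝ) ≤ k)]
  have h5 : (1 : ℝ) ≤ Real.exp 2 := Real.one_le_exp (by norm_num)
  have hk : (0 : ℝ) ≤ k := Nat.cast_nonneg k
  calc (2 : ℝ) ^ N * (2 + 8 * N) ≤ 4 ^ (k + 1) * (18 * (k + 1)) := by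
        gcongr
        linarith
    _ ≤ 4 ^ (k + 1) * (2 * 9 ^ (k + 1) * 2 ^ (k + 1)) := by
        gcongr ?_ * ?_
        nlinarith
    _ = 2 * 72 ^ (k + 1) := by
        rw [show (72 : ℝ) = 4 * 9 * 2 by norm_num, mul_pow, mul_pow]
        ring
    _ ≤ 2 * (6 ^ 10) ^ (k + 1) := by
        gcongr
        norm_num
    _ = 2 * 1 * 6 ^ (10 * (k + 1)) := by rw [pow_mul, mul_one]
    _ ≤ _ := by gcongr

end Numerics

theorem product_taylor_approx (d m : ℕ) (hd : 2 ≤ d) (hm2 : 2 ≤ m) (hmd : m ≤ d)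
    (i : Fin (2 * m - 2) → ℕ) (hipos : ∀ k, 0 < i k) (hile : ∀ k, i k ≤ d)
    (hisum : ∑ k, i k = m * (m - 1))
    (ε : ℝ)
    (hε : ε = ((3 * d : ℝ)) ^ (-(12 * d : ℝ)) * ((50 * d : ℝ)) ^ (-(3 * (d : ℝ) ^ 2 / 2)))
    (T : ℝ → ℝ)
    (hT : T = fun x : ℝ =>
      ∑ r ∈ Finset.range (3 * m * (m - 1) / 2 + 1),
        iteratedDeriv r (fun y : ℝ => ∏ k, Rfun (d - i k) y) 0 / (r.factorial : ℝ) * x ^ r)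
    (n : ℕ) (hn : 1 ≤ n) (hw : wfun n ∈ Set.Ioc 0 ε) :
    |(∏ k, ((partitionFun (n + d - i k) : ℝ) / (partitionFun n : ℝ))) - T (wfun n)| ≤
      2 * Real.exp 2 * (3 * d : ℝ) ^ (10 * d - 10) *
        (4 * cconst * d : ℝ) ^ (3 * (d : ℝ) ^ 2 / 2) *
        wfun n ^ (3 * m * (m - 1) / 2 + 1) := by
  have hc := six_le_cconst
  have hc7 := cconst_le_seven
  have hd' : (2 : ℝ) ≤ d := by exact_mod_cast hd
  have hn' : (1 : ℝ) ≤ n := by exact_mod_cast hn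
  set u := Real.sqrt (cconst * ((n : ℝ) - 1 / 24)) with hu
  have hwu : wfun n = 1 / u := rfl
  have hu0 : 0 < u := Real.sqrt_pos.mpr (mul_pos (by linarith) (by linarith))
  have hun : u ^ 2 = cconst * (n - 1 / 24) :=
    Real.sq_sqrt (mul_nonneg (by linarith) (by linarith))
  have hεle : ε ≤ 1 / (3 * d : ℝ) ^ 24 := by
    rw [hε]
    have h1 : ((3 * d : ℝ)) ^ (-(12 * d : ℝ)) ≤ 1 / (3 * d : ℝ) ^ 24 := by
      rw [one_div, Real.rpow_neg (by positivity), ← Real.rpow_natCast (3 * d : ℝ) 24]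
      refine inv_anti₀ (by positivity) (Real.rpow_le_rpow_of_exponent_le (by linarith) ?_)
      push_cast
      linarith
    have h2 : ((50 * d : ℝ)) ^ (-(3 * (d : ℝ) ^ 2 / 2)) ≤ 1 :=
      Real.rpow_le_one_of_one_le_of_nonpos (by linarith) (by
        have := sq_nonneg (d : ℝ)
        linarith)
    calc _ ≤ 1 / (3 * d : ℝ) ^ 24 * 1 := by gcongr
      _ = _ := mul_one _
  have hu24 : (3 * d : ℝ) ^ 24 ≤ u := by
    have h1 := hw.2.trans hεle
    rw [hwu] at h1
    exact (one_div_le_one_div hu0 (by positivity)).mp h1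
  have hd6 : (6 : ℝ) ≤ 3 * d := by linarith
  have hu10 : 10 ^ 10 ≤ u := by
    refine le_trans ?_ hu24
    calc (10 : ℝ) ^ 10 ≤ 6 ^ 24 := by norm_num
      _ ≤ _ := by gcongr
  have hud8 : 8 * cconst * d ≤ u := by
    refine le_trans ?_ hu24
    calc 8 * cconst * d ≤ 6 ^ 23 * (3 * d) := by nlinarith
      _ ≤ (3 * d : ℝ) ^ 23 * (3 * d) := by gcongr
      _ = (3 * d : ℝ) ^ 24 := by ring
  have hyu : (3 * (d : ℝ) ^ 2 / 2) ^ 4 ≤ u := by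
    refine le_trans ?_ hu24
    calc (3 * (d : ℝ) ^ 2 / 2) ^ 4 ≤ ((3 * d : ℝ) ^ 2) ^ 4 := by
          gcongr
          nlinarith
      _ = (3 * d : ℝ) ^ 8 := by ring
      _ ≤ _ := pow_le_pow_right₀ (by linarith) (by norm_num)
  set L := 3 * m * (m - 1) / 2 + 1 with hL
  have hLy : (L : ℝ) ≤ 3 * (d : ℝ) ^ 2 / 2 := by
    have h1 : 2 * L ≤ 3 * d ^ 2 := by
      have h2 : 2 * (3 * m * (m - 1) / 2) ≤ 3 * m * (m - 1) := Nat.mul_div_le _ _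
      have h3 : 3 * m * (m - 1) ≤ 3 * d * (d - 1) :=
        Nat.mul_le_mul (Nat.mul_le_mul_left 3 hmd) (Nat.sub_le_sub_right hmd 1)
      have h4 : 3 * d * (d - 1) + 3 * d = 3 * d ^ 2 := by
        obtain ⟨k, rfl⟩ : ∃ k, d = k + 1 := ⟨d - 1, by omega⟩
        rw [Nat.add_sub_cancel]
        ring
      omega
    have h5 : (2 : ℝ) * L ≤ 3 * (d : ℝ) ^ 2 := by exact_mod_cast h1
    linarith
  have hexp : Real.exp (-(u / 30)) ≤ (1 / u) ^ L := exp_neg_div_le_pow hyu hu10 hLy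
  have hNle : 2 * m - 2 ≤ 2 * d - 2 := by omega
  obtain ⟨N, hN⟩ : ∃ N, N = 2 * m - 2 := ⟨_, rfl⟩
  have hcard : Fintype.card (Fin (2 * m - 2)) = N := by rw [Fintype.card_fin, hN]
  rw [← hN] at hNle
  have hNd : (N : ℝ) ≤ 2 * d := by exact_mod_cast (by omega : N ≤ 2 * d)
  have hsmall : 4 * Fintype.card (Fin (2 * m - 2)) * Real.exp (-(u / 30)) ≤ 1 := by
    rw [hcard]
    have h1 : (1 / u) ^ L ≤ 1 / u := pow_le_of_le_one (by positivity)
      (by rw [div_le_one hu0]; linarith) (by omega)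
    calc 4 * (N : ℝ) * Real.exp (-(u / 30)) ≤ 4 * (2 * d) * (1 / u) := by
          gcongr
          exact hexp.trans h1
      _ ≤ 1 := by
        rw [mul_one_div, div_le_one hu0]
        nlinarith
  have hj : ∀ k, d - i k ≤ d := fun k => Nat.sub_le _ _
  have hA := abs_prod_partitionFun_div_sub_le hd (fun k => d - i k) hj n hu10
    (by nlinarith) hun hsmall
  have hB := abs_prod_Rfun_sub_taylor_le hd (fun k => d - i k) hj L (x := 1 / u) (by positivity)
    (one_div_le_one_div_of_le (by positivity) hud8)
  rw [hcard] at hA hB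
  have hprod : ∏ k, ((partitionFun (n + d - i k) : ℝ) / (partitionFun n : ℝ)) =
      ∏ k, ((partitionFun (n + (d - i k)) : ℝ) / (partitionFun n : ℝ)) :=
    Finset.prod_congr rfl fun k _ => by rw [Nat.add_sub_assoc (hile k)]
  rw [hprod, hT, hwu]
  refine (abs_sub_le _ _ _).trans ((add_le_add hA hB).trans ?_)
  set y := 3 * (d : ℝ) ^ 2 / 2 with hy
  have hX : 1 ≤ 4 * cconst * d := by nlinarith
  have hXL : (4 * cconst * d) ^ L ≤ (4 * cconst * d) ^ y := by
    rw [← Real.rpow_natCast]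
    exact Real.rpow_le_rpow_of_exponent_le hX hLy
  have hX1 : 1 ≤ (4 * cconst * d) ^ y := Real.one_le_rpow hX (by positivity)
  calc (2 : ℝ) ^ N * (8 * N * Real.exp (-(u / 30))) + 2 * 2 ^ N * (4 * cconst * d * (1 / u)) ^ L ≤
      2 ^ N * (8 * N * (1 * (1 / u) ^ L)) +
        2 * 2 ^ N * ((4 * cconst * d) ^ y * (1 / u) ^ L) := by
        rw [mul_pow, one_mul]
        gcongr
    _ ≤ 2 ^ N * (8 * N * ((4 * cconst * d) ^ y * (1 / u) ^ L)) +
        2 * 2 ^ N * ((4 * cconst * d) ^ y * (1 / u) ^ L) := by gcongr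
    _ = 2 ^ N * (2 + 8 * N) * ((4 * cconst * d) ^ y * (1 / u) ^ L) := by ring
    _ ≤ 2 * Real.exp 2 * (3 * d : ℝ) ^ (10 * d - 10) *
        ((4 * cconst * d) ^ y * (1 / u) ^ L) :=
        mul_le_mul_of_nonneg_right (two_pow_mul_le hd hNle) (by positivity)
    _ = _ := by ring
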